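/- Let 0 < p < 1. A function f ∈ L^2(T) belongs to Q_p(T) if and only if the measure |∇f̃(z)|^2 (1 - |z|^2)^p dA(z) is a p-Carleson measure on the unit disk D, where f̃ denotes the Poisson integral (harmonic extension) of f. -/

import Mathlib

open MeasureTheory Complex Metric Set Filter
open scoped ENNReal Real

noncomputable section

/-- The open unit disk in `ℂ`. -/
def unitDisk : Set ℂ := Metric.ball 0 1

/-- The Möbius automorphism `φ_a(z) = (a - z)/(1 - ā z)` of the unit disk. -/
def moebius (a z : ℂ) : ℂ := (a - z) / (1 - (starRingEnd ℂ) a * z)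

/-- Membership in `H^∞(𝔻)`: bounded analytic functions on the unit disk. -/
def MemHinf (f : ℂ → ℂ) : Prop :=
  DifferentiableOn ℂ f unitDisk ∧ ∃ M : ℝ, ∀ z ∈ unitDisk, ‖f z‖ ≤ M

/-- The integral `∫_𝔻 |f'(z)|² (1 - |φ_a(z)|²)^p dA(z)`. -/
def qpIntegral (p : ℝ) (f : ℂ → ℂ) (a : ℂ) : ℝ≥0∞ :=
  ∫⁻ z in unitDisk, ENNReal.ofReal (‖deriv f z‖ ^ 2 * (1 - ‖moebius a z‖ ^ 2) ^ p)

/-- Finiteness of the `H²`-part of the `Q_p` norm: the integrals of `|f|²` over circles of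
radius `r < 1` are uniformly bounded (equivalently, the boundary integral `∫ |f|² dσ`
is finite). -/
def h2Bounded (f : ℂ → ℂ) : Prop :=
  ∃ M : ℝ, ∀ r ∈ Set.Ico (0 : ℝ) 1,
    (∫ t in (0 : ℝ)..(2 * Real.pi), ‖f ((r : ℂ) * Complex.exp (Complex.I * t))‖ ^ 2) ≤ M

/-- Membership in the space `Q_p`: `f` is analytic on the unit disk and
`‖f‖_{Q_p}² = ∫_𝕋 |f|² dσ + sup_{a ∈ 𝔻} ∫_𝔻 |f'(z)|² (1 - |φ_a(z)|²)^p dA(z) < ∞`. -/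
def MemQp (p : ℝ) (f : ℂ → ℂ) : Prop :=
  DifferentiableOn ℂ f unitDisk ∧ h2Bounded f ∧
    ∃ C : ℝ, ∀ a ∈ unitDisk, qpIntegral p f a ≤ ENNReal.ofReal C

/-- The multiplier algebra `M(Q_p)`. -/
def MemMQp (p : ℝ) (φ : ℂ → ℂ) : Prop :=
  MemQp p φ ∧ ∀ f : ℂ → ℂ, MemQp p f → MemQp p (fun z => φ z * f z)

/-- The Carleson square `S(I)` over the arc of the unit circle centered at `e^{iθ}` with
normalized length `h`. -/
def carlesonBox (θ h : ℝ) : Set ℂ :=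
  {z : ℂ | 1 - h < ‖z‖ ∧ ‖z‖ < 1 ∧
    ∃ t : ℝ, |t - θ| < Real.pi * h ∧ z = (‖z‖ : ℂ) * Complex.exp (Complex.I * t)}

/-- A measure `μ` on the unit disk is a `p`-Carleson measure if `μ(S(I)) ≤ C |I|^p`
for every arc `I` of the unit circle. -/
def IsPCarleson (p : ℝ) (μ : Measure ℂ) : Prop :=
  ∃ C : ℝ, ∀ θ : ℝ, ∀ h ∈ Set.Ioc (0 : ℝ) 1,
    μ (carlesonBox θ h) ≤ ENNReal.ofReal (C * h ^ p)

/-- The `p`-Carleson constant `‖μ‖_p = sup_{I ⊂ 𝕋} μ(S(I))/|I|^p`. -/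
def pCarlesonNorm (p : ℝ) (μ : Measure ℂ) : ℝ≥0∞ :=
  ⨆ (θ : ℝ) (h : ℝ) (_ : h ∈ Set.Ioc (0 : ℝ) 1),
    μ (carlesonBox θ h) / ENNReal.ofReal (h ^ p)

/-- The measure `w(z) dA(z)` on the unit disk. -/
def diskMeasure (w : ℂ → ℝ) : Measure ℂ :=
  (volume.restrict unitDisk).withDensity fun z => ENNReal.ofReal (w z)

/-- The Wirtinger derivative `∂F/∂z`. -/
def wderiv (F : ℂ → ℂ) (z : ℂ) : ℂ :=
  (fderiv ℝ F z 1 - Complex.I * fderiv ℝ F z Complex.I) / 2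

/-- The Wirtinger derivative `∂F/∂z̄`. -/
def wderivBar (F : ℂ → ℂ) (z : ℂ) : ℂ :=
  (fderiv ℝ F z 1 + Complex.I * fderiv ℝ F z Complex.I) / 2

/-- The squared length of the (real) gradient: `|∇F|² = 2|∂F/∂z|² + 2|∂F/∂z̄|²`. -/
def gradSq (F : ℂ → ℂ) (z : ℂ) : ℝ :=
  2 * ‖wderiv F z‖ ^ 2 + 2 * ‖wderivBar F z‖ ^ 2

/-- The arc of the unit circle centered at `e^{iθ}` of normalized length `h`, parametrized
by angle. -/
def arcInterval (θ h : ℝ) : Set ℝ := Set.Ioo (θ - Real.pi * h) (θ + Real.pi * h)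

/-- The double integral `∫_I ∫_I |f(ξ) - f(η)|²/|ξ - η|^{2-p} |dξ| |dη|` over the arc
centered at `e^{iθ}` of normalized length `h`. -/
def qpTDouble (p : ℝ) (f : ℝ → ℂ) (θ h : ℝ) : ℝ≥0∞ :=
  ∫⁻ s in arcInterval θ h, ∫⁻ u in arcInterval θ h,
    ENNReal.ofReal (‖f s - f u‖ ^ 2 /
      ‖Complex.exp (Complex.I * s) - Complex.exp (Complex.I * u)‖ ^ (2 - p))

/-- The integral `∫_𝕋 |f|² dσ` of a function on the unit circle (parametrized by angle). -/
def l2Circle (f : ℝ → ℂ) : ℝ≥0∞ :=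
  ∫⁻ t in Set.Ioc (0 : ℝ) (2 * Real.pi), (‖f t‖₊ : ℝ≥0∞) ^ 2

/-- Membership in `Q_p(𝕋)` for a function on the unit circle (parametrized by angle):
`f ∈ L²(𝕋)` and `sup_{I ⊂ 𝕋} |I|^{-p} ∫_I ∫_I |f(ξ) - f(η)|²/|ξ - η|^{2-p} |dξ||dη| < ∞`. -/
def MemQpT (p : ℝ) (f : ℝ → ℂ) : Prop :=
  Function.Periodic f (2 * Real.pi) ∧ Measurable f ∧ l2Circle f < ⊤ ∧
    ∃ C : ℝ, ∀ θ : ℝ, ∀ h ∈ Set.Ioc (0 : ℝ) 1, qpTDouble p f θ h ≤ ENNReal.ofReal (C * h ^ p)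

/-- The square of the `Q_p` norm of an analytic function `f` on the disk with boundary
values `fb`. -/
def qpNormSq (p : ℝ) (f : ℂ → ℂ) (fb : ℝ → ℂ) : ℝ≥0∞ :=
  l2Circle fb + ⨆ a ∈ unitDisk, qpIntegral p f a

/-- The square of the `Q_p(𝕋)` norm of a function on the unit circle. -/
def qpTNormSq (p : ℝ) (fb : ℝ → ℂ) : ℝ≥0∞ :=
  l2Circle fb + ⨆ (θ : ℝ) (h : ℝ) (_ : h ∈ Set.Ioc (0 : ℝ) 1),
    qpTDouble p fb θ h / ENNReal.ofReal (h ^ p)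

/-- `fb` is the a.e. radial boundary-value function of `F`. -/
def RadialLimit (F : ℂ → ℂ) (fb : ℝ → ℂ) : Prop :=
  ∀ᵐ t : ℝ, Filter.Tendsto (fun r : ℝ => F ((r : ℂ) * Complex.exp (Complex.I * t)))
    (nhdsWithin 1 (Set.Iio 1)) (nhds (fb t))

/-- The Poisson integral (harmonic extension) of a function on the unit circle. -/
def poissonExt (f : ℝ → ℂ) (z : ℂ) : ℂ :=
  (1 / (2 * Real.pi)) • ∫ t in (0 : ℝ)..(2 * Real.pi),
    ((1 - ‖z‖ ^ 2) / ‖Complex.exp (Complex.I * t) - z‖ ^ 2) • f t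


open scoped Topology


/-- The point `e^{it}` of the unit circle. -/
def ee (t : ℝ) : ℂ := Complex.exp (Complex.I * t)

lemma norm_ee (t : ℝ) : ‖ee t‖ = 1 := by
  unfold ee; rw [mul_comm]; exact Complex.norm_exp_ofReal_mul_I t

lemma continuous_ee : Continuous ee := by unfold ee; fun_prop

lemma ee_ne_zero (t : ℝ) : ee t ≠ 0 := Complex.exp_ne_zero _

lemma ee_periodic : Function.Periodic ee (2 * π) := by
  intro t
  unfold ee
  push_cast
  rw [show I * ((t : ℂ) + 2 * π) = I * t + 2 * π * I by ring, Complex.exp_add,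
    Complex.exp_two_pi_mul_I, mul_one]

lemma ee_sub_lower (t : ℝ) (z : ℂ) : 1 - ‖z‖ ≤ ‖ee t - z‖ := by
  have := norm_sub_norm_le (ee t) z
  rwa [norm_ee] at this

lemma ee_sub_ne {z : ℂ} (hz : ‖z‖ < 1) (t : ℝ) : ee t - z ≠ 0 := by
  intro h
  have := ee_sub_lower t z
  rw [h, norm_zero] at this
  linarith

/-- The Cauchy transform. -/
def HH (f : ℝ → ℂ) (z : ℂ) : ℂ :=
  (1 / (2 * π) : ℂ) * ∫ t in (0 : ℝ)..(2 * π), f t * (ee t / (ee t - z))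

/-- The derivative of the Cauchy transform. -/
def HD (f : ℝ → ℂ) (z : ℂ) : ℂ :=
  (1 / (2 * π) : ℂ) * ∫ t in (0 : ℝ)..(2 * π), f t * (ee t / (ee t - z) ^ 2)

lemma cont_k1 {z : ℂ} (hz : ‖z‖ < 1) : Continuous fun t => ee t / (ee t - z) :=
  continuous_ee.div (continuous_ee.sub continuous_const) (ee_sub_ne hz)

lemma cont_k2 {z : ℂ} (hz : ‖z‖ < 1) : Continuous fun t => ee t / (ee t - z) ^ 2 :=
  continuous_ee.div ((continuous_ee.sub continuous_const).pow 2)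
    (fun t => pow_ne_zero 2 (ee_sub_ne hz t))

lemma hasDerivAt_HH {f : ℝ → ℂ} (hf : IntervalIntegrable f volume 0 (2 * π)) {z : ℂ}
    (hz : ‖z‖ < 1) : HasDerivAt (HH f) (HD f z) z := by
  unfold HH HD
  apply HasDerivAt.const_mul
  set ρ := (1 - ‖z‖) / 2 with hρ
  have hρ0 : 0 < ρ := by rw [hρ]; linarith
  have hball : ∀ w ∈ ball z ρ, ‖w‖ < 1 - ρ := by
    intro w hw
    have h1 : ‖w - z‖ < ρ := by simpa [dist_eq_norm] using hw
    have h2 : ‖w‖ ≤ ‖w - z‖ + ‖z‖ := by simpa using norm_add_le (w - z) z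
    rw [hρ] at *
    linarith
  have hball1 : ∀ w ∈ ball z ρ, ‖w‖ < 1 := fun w hw => by linarith [hball w hw]
  have hmem : ball z ρ ∈ nhds z := ball_mem_nhds z hρ0
  have hm : AEStronglyMeasurable f (volume.restrict (uIoc 0 (2 * π))) :=
    (intervalIntegrable_iff.1 hf).aestronglyMeasurable
  refine (intervalIntegral.hasDerivAt_integral_of_dominated_loc_of_deriv_le
    (F := fun z t => f t * (ee t / (ee t - z)))
    (F' := fun z t => f t * (ee t / (ee t - z) ^ 2))
    (bound := fun t => ‖f t‖ * (1 / ρ ^ 2)) hmem ?_ ?_ ?_ ?_ ?_ ?_).2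
  · filter_upwards [hmem] with w hw
    exact hm.mul (cont_k1 (hball1 w hw)).aestronglyMeasurable
  · exact hf.mul_continuousOn (cont_k1 hz).continuousOn
  · exact hm.mul (cont_k2 hz).aestronglyMeasurable
  · refine ae_of_all _ fun t _ w hw => ?_
    rw [norm_mul, norm_div, norm_pow, norm_ee]
    have h1 := ee_sub_lower t w
    have h2 := hball w hw
    gcongr
    linarith
  · exact hf.norm.mul_const _
  · refine ae_of_all _ fun t _ w hw => ?_
    have hne := ee_sub_ne (hball1 w hw) t
    have h1 : HasDerivAt (fun x : ℂ => ee t - x) (-1) w := by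
      simpa using (hasDerivAt_id w).const_sub (ee t)
    have h2 := ((hasDerivAt_const w (ee t)).div h1 hne).const_mul (f t)
    refine h2.congr_deriv ?_
    simp

lemma HH_one {z : ℂ} (hz : ‖z‖ < 1) : HH (fun _ => 1) z = 1 := by
  have h := circleIntegral.integral_sub_inv_of_mem_ball (c := 0) (w := z) (R := 1)
    (by simpa using hz)
  rw [circleIntegral] at h
  have h2 : ∀ t : ℝ, deriv (circleMap 0 1) t • (circleMap 0 1 t - z)⁻¹
      = I * (1 * (ee t / (ee t - z))) := by
    intro t
    rw [deriv_circleMap]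
    simp [circleMap, ee, mul_comm I]
    ring
  simp_rw [h2] at h
  rw [intervalIntegral.integral_const_mul] at h
  unfold HH
  have hI : I ≠ 0 := I_ne_zero
  have hpi : (π : ℂ) ≠ 0 := by exact_mod_cast Real.pi_ne_zero
  have h3 : (∫ t in (0 : ℝ)..(2 * π), 1 * (ee t / (ee t - z))) = 2 * π := by
    apply mul_left_cancel₀ hI
    rw [h]; ring
  rw [h3]
  field_simp

lemma HD_const {z : ℂ} (hz : ‖z‖ < 1) (c : ℂ) : HD (fun _ => c) z = 0 := by
  have h1 := hasDerivAt_HH (f := fun _ => (1 : ℂ)) intervalIntegrable_const hz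
  have h2 : HasDerivAt (HH fun _ => 1) 0 z := by
    refine (hasDerivAt_const z (1 : ℂ)).congr_of_eventuallyEq ?_
    have : ball (0 : ℂ) 1 ∈ nhds z := isOpen_ball.mem_nhds (by simpa using hz)
    filter_upwards [this] with w hw
    exact HH_one (by simpa using hw)
  have h3 := h1.unique h2
  unfold HD at *
  have : (fun t => c * (ee t / (ee t - z) ^ 2)) = fun t => c * (1 * (ee t / (ee t - z) ^ 2)) := by
    ext; ring
  rw [this, intervalIntegral.integral_const_mul]
  rw [mul_left_comm, h3, mul_zero]

lemma HD_sub_const {f : ℝ → ℂ} (hf : IntervalIntegrable f volume 0 (2 * π)) {z : ℂ}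
    (hz : ‖z‖ < 1) (c : ℂ) : HD f z = HD (fun t => f t - c) z := by
  have h0 := HD_const hz c
  have : HD (fun t => f t - c) z = HD f z - HD (fun _ => c) z := by
    unfold HD
    rw [← mul_sub, ← intervalIntegral.integral_sub]
    · congr 2; ext t; ring
    · exact hf.mul_continuousOn (cont_k2 hz).continuousOn
    · exact intervalIntegrable_const.mul_continuousOn (cont_k2 hz).continuousOn
  rw [this, h0, sub_zero]

lemma poisson_kernel_eq {z : ℂ} (hz : ‖z‖ < 1) (t : ℝ) :
    (((1 - ‖z‖ ^ 2) / ‖ee t - z‖ ^ 2 : ℝ) : ℂ)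
      = ee t / (ee t - z) + (starRingEnd ℂ) (ee t / (ee t - z)) - 1 := by
  have h1 := ee_sub_ne hz t
  have h2 : (starRingEnd ℂ) (ee t - z) ≠ 0 := (map_ne_zero _).2 h1
  have h3 : (starRingEnd ℂ) (ee t) * ee t = 1 := by
    rw [mul_comm, Complex.mul_conj, Complex.normSq_eq_norm_sq, norm_ee]; simp
  push_cast
  rw [← Complex.conj_mul' z, ← Complex.conj_mul' (ee t - z), map_div₀]
  rw [map_sub] at *
  field_simp
  linear_combination (-1) * h3

lemma poissonExt_eq {f : ℝ → ℂ} (hf : IntervalIntegrable f volume 0 (2 * π)) {z : ℂ}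
    (hz : ‖z‖ < 1) : poissonExt f z = HH f z + (starRingEnd ℂ) (HH (fun t => (starRingEnd ℂ) (f t)) z)
      - (1 / (2 * π) : ℂ) * ∫ t in (0 : ℝ)..(2 * π), f t := by
  unfold poissonExt HH
  have hc : IntervalIntegrable (fun t => (starRingEnd ℂ) (f t)) volume 0 (2 * π) := by
    rw [intervalIntegrable_iff] at *
    exact (Complex.conjCLE.integrable_comp_iff).2 hf
  rw [map_mul, ← intervalIntegral.intervalIntegral_conj]
  simp only [map_div₀, map_mul, map_one, map_ofNat, Complex.conj_ofReal, Complex.conj_conj]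
  rw [← mul_add, ← mul_sub, ← intervalIntegral.integral_add, ← intervalIntegral.integral_sub]
  · rw [Complex.real_smul]
    push_cast
    congr 1
    apply intervalIntegral.integral_congr
    intro t _
    have := poisson_kernel_eq hz t
    simp only [Complex.real_smul]
    change (((1 - ‖z‖ ^ 2) / ‖ee t - z‖ ^ 2 : ℝ) : ℂ) * f t = _
    rw [this, map_div₀]
    ring
  · apply IntervalIntegrable.add
    · exact hf.mul_continuousOn (cont_k1 hz).continuousOn
    · refine hf.mul_continuousOn ?_
      have := (Complex.continuous_conj.comp (cont_k1 hz)).continuousOn (s := uIcc 0 (2 * π))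
      refine this.congr ?_
      intro t _
      simp
  · exact hf
  · exact hf.mul_continuousOn (cont_k1 hz).continuousOn
  · refine hf.mul_continuousOn ?_
    have := (Complex.continuous_conj.comp (cont_k1 hz)).continuousOn (s := uIcc 0 (2 * π))
    refine this.congr ?_
    intro t _
    simp



/-- Cauchy-Schwarz for lower integrals. -/
lemma cs_lintegral {α : Type*} [MeasurableSpace α] {μ : Measure α} {a b : α → ℝ≥0∞}
    (ha : AEMeasurable a μ) (hb : AEMeasurable b μ) :
    (∫⁻ x, a x * b x ∂μ) ^ 2 ≤ (∫⁻ x, a x ^ 2 ∂μ) * ∫⁻ x, b x ^ 2 ∂μ := by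
  have h := ENNReal.lintegral_mul_le_Lp_mul_Lq μ (p := 2) (q := 2)
    (Real.holderConjugate_iff.2 ⟨by norm_num, by norm_num⟩) ha hb
  simp only [Pi.mul_apply, ENNReal.rpow_two] at h
  calc (∫⁻ x, a x * b x ∂μ) ^ 2 ≤ ((∫⁻ x, a x ^ 2 ∂μ) ^ (1 / 2 : ℝ) *
        (∫⁻ x, b x ^ 2 ∂μ) ^ (1 / 2 : ℝ)) ^ 2 := by gcongr
    _ = _ := by
      rw [mul_pow, ← ENNReal.rpow_natCast, ← ENNReal.rpow_natCast, ← ENNReal.rpow_mul,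
        ← ENNReal.rpow_mul]
      norm_num

/-- Conjugate function. -/
def cf (f : ℝ → ℂ) : ℝ → ℂ := fun t => (starRingEnd ℂ) (f t)

lemma cf_integrable {f : ℝ → ℂ} (hf : IntervalIntegrable f volume 0 (2 * π)) :
    IntervalIntegrable (cf f) volume 0 (2 * π) := by
  unfold cf
  rw [intervalIntegrable_iff] at *
  exact (Complex.conjCLE.integrable_comp_iff).2 hf

lemma poissonExt_eventuallyEq {f : ℝ → ℂ} (hf : IntervalIntegrable f volume 0 (2 * π)) {z : ℂ}
    (hz : ‖z‖ < 1) : poissonExt f =ᶠ[nhds z] fun w => HH f w + (starRingEnd ℂ) (HH (cf f) w)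
      - (1 / (2 * π) : ℂ) * ∫ t in (0 : ℝ)..(2 * π), f t := by
  have : ball (0 : ℂ) 1 ∈ nhds z := isOpen_ball.mem_nhds (by simpa using hz)
  filter_upwards [this] with w hw
  exact poissonExt_eq hf (by simpa using hw)

lemma hasFDerivAt_poissonExt {f : ℝ → ℂ} (hf : IntervalIntegrable f volume 0 (2 * π)) {z : ℂ}
    (hz : ‖z‖ < 1) : HasFDerivAt (𝕜 := ℝ) (poissonExt f)
      ((ContinuousLinearMap.toSpanSingleton ℂ (HD f z)).restrictScalars ℝ +
        Complex.conjCLE.toContinuousLinearMap.comp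
        ((ContinuousLinearMap.toSpanSingleton ℂ (HD (cf f) z)).restrictScalars ℝ)) z := by
  have h1 := ((hasDerivAt_HH hf hz).hasFDerivAt).restrictScalars ℝ
  have h2 := ((hasDerivAt_HH (cf_integrable hf) hz).hasFDerivAt).restrictScalars ℝ
  have h3 := (Complex.conjCLE.toContinuousLinearMap.hasFDerivAt).comp z h2
  have h4 := (h1.add h3).sub_const ((1 / (2 * π) : ℂ) * ∫ t in (0 : ℝ)..(2 * π), f t)
  exact h4.congr_of_eventuallyEq (poissonExt_eventuallyEq hf hz)

lemma fderiv_poissonExt_apply {f : ℝ → ℂ} (hf : IntervalIntegrable f volume 0 (2 * π)) {z : ℂ}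
    (hz : ‖z‖ < 1) (v : ℂ) : fderiv ℝ (poissonExt f) z v =
      v * HD f z + (starRingEnd ℂ) (v * HD (cf f) z) := by
  rw [(hasFDerivAt_poissonExt hf hz).fderiv]
  simp [ContinuousLinearMap.toSpanSingleton_apply]

lemma gradSq_eq {f : ℝ → ℂ} (hf : IntervalIntegrable f volume 0 (2 * π)) {z : ℂ}
    (hz : ‖z‖ < 1) :
    gradSq (poissonExt f) z = 2 * ‖HD f z‖ ^ 2 + 2 * ‖HD (cf f) z‖ ^ 2 := by
  unfold gradSq wderiv wderivBar
  rw [fderiv_poissonExt_apply hf hz, fderiv_poissonExt_apply hf hz]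
  have e1 : (1 * HD f z + (starRingEnd ℂ) (1 * HD (cf f) z)
      - I * (I * HD f z + (starRingEnd ℂ) (I * HD (cf f) z))) / 2 = HD f z := by
    simp only [map_mul, conj_I, one_mul]
    linear_combination (-(HD f z)/2 + (starRingEnd ℂ) (HD (cf f) z)/2) * I_mul_I
  have e2 : (1 * HD f z + (starRingEnd ℂ) (1 * HD (cf f) z)
      + I * (I * HD f z + (starRingEnd ℂ) (I * HD (cf f) z))) / 2
      = (starRingEnd ℂ) (HD (cf f) z) := by
    simp only [map_mul, conj_I, one_mul]
    linear_combination ((HD f z)/2 - (starRingEnd ℂ) (HD (cf f) z)/2) * I_mul_I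
  rw [e1, e2, Complex.norm_conj]

lemma gradSq_nonneg (F : ℂ → ℂ) (z : ℂ) : 0 ≤ gradSq F z := by
  unfold gradSq; positivity

lemma measurable_gradSq (F : ℂ → ℂ) : Measurable (gradSq F) := by
  unfold gradSq wderiv wderivBar
  have h := measurable_fderiv ℝ F
  have h1 : Measurable fun z => fderiv ℝ F z 1 := measurable_fderiv_apply_const ℝ F 1
  have h2 : Measurable fun z => fderiv ℝ F z I := measurable_fderiv_apply_const ℝ F I
  fun_prop

lemma norm_fderiv_poissonExt_le {f : ℝ → ℂ} (hf : IntervalIntegrable f volume 0 (2 * π)) {z : ℂ}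
    (hz : ‖z‖ < 1) (v : ℂ) :
    ‖fderiv ℝ (poissonExt f) z v‖ ≤ √(gradSq (poissonExt f) z) * ‖v‖ := by
  rw [fderiv_poissonExt_apply hf hz, gradSq_eq hf hz]
  calc _ ≤ ‖v * HD f z‖ + ‖(starRingEnd ℂ) (v * HD (cf f) z)‖ := norm_add_le _ _
    _ = (‖HD f z‖ + ‖HD (cf f) z‖) * ‖v‖ := by
      rw [Complex.norm_conj, norm_mul, norm_mul]; ring
    _ ≤ _ := by
      gcongr
      apply Real.le_sqrt_of_sq_le
      nlinarith [sq_nonneg (‖HD f z‖ - ‖HD (cf f) z‖)]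

lemma contDiffOn_poissonExt {f : ℝ → ℂ} (hf : IntervalIntegrable f volume 0 (2 * π)) :
    ContDiffOn ℝ 1 (poissonExt f) (ball 0 1) := by
  have key : ∀ g : ℝ → ℂ, IntervalIntegrable g volume 0 (2 * π) →
      ContDiffOn ℝ 1 (HH g) (ball 0 1) := by
    intro g hg
    have : DifferentiableOn ℂ (HH g) (ball 0 1) := fun z hz =>
      (hasDerivAt_HH hg (by simpa using hz)).differentiableAt.differentiableWithinAt
    exact (this.contDiffOn (n := 1) isOpen_ball).restrict_scalars ℝ
  have h1 := (key f hf).add (Complex.conjCLE.contDiff.comp_contDiffOn (key _ (cf_integrable hf)))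
  have h2 := h1.sub (contDiffOn_const (c := (1 / (2 * π) : ℂ) * ∫ t in (0 : ℝ)..(2 * π), f t))
  refine h2.congr fun z hz => ?_
  exact poissonExt_eq hf (by simpa using hz)

lemma integral_poisson_kernel {z : ℂ} (hz : ‖z‖ < 1) :
    ∫ t in (0 : ℝ)..(2 * π), (1 - ‖z‖ ^ 2) / ‖ee t - z‖ ^ 2 = 2 * π := by
  have h := poissonExt_eq (f := fun _ => 1) intervalIntegrable_const hz
  simp only [map_one] at h
  rw [HH_one hz] at h
  have hpi : (π : ℂ) ≠ 0 := by exact_mod_cast Real.pi_ne_zero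
  have h2 : poissonExt (fun _ => 1) z = 1 := by
    rw [h]; simp
    field_simp
    ring
  unfold poissonExt at h2
  have h3 : ∀ t : ℝ, ((1 - ‖z‖ ^ 2) / ‖Complex.exp (Complex.I * t) - z‖ ^ 2) • (1 : ℂ)
    = (((1 - ‖z‖ ^ 2) / ‖ee t - z‖ ^ 2 : ℝ) : ℂ) := by
    intro t; rw [Complex.real_smul, mul_one]; rfl
  simp_rw [h3] at h2
  rw [intervalIntegral.integral_ofReal, Complex.real_smul, ← Complex.ofReal_mul] at h2
  have h4 := Complex.ofReal_injective (h2.trans Complex.ofReal_one.symm)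
  have := Real.pi_pos
  field_simp at h4
  linarith

lemma cont_pk {z : ℂ} (hz : ‖z‖ < 1) : Continuous fun t => (1 - ‖z‖ ^ 2) / ‖ee t - z‖ ^ 2 :=
  continuous_const.div (((continuous_ee.sub continuous_const).norm).pow 2)
    (fun t => pow_ne_zero 2 (norm_ne_zero_iff.2 (ee_sub_ne hz t)))

lemma one_sub_sq_pos {z : ℂ} (hz : ‖z‖ < 1) : 0 < 1 - ‖z‖ ^ 2 := by
  nlinarith [norm_nonneg z]

lemma lintegral_poisson_kernel {z : ℂ} (hz : ‖z‖ < 1) :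
    ∫⁻ t in Ioc (0 : ℝ) (2 * π), ENNReal.ofReal ((1 - ‖z‖ ^ 2) / ‖ee t - z‖ ^ 2)
      = ENNReal.ofReal (2 * π) := by
  rw [← ofReal_integral_eq_lintegral_ofReal, ← intervalIntegral.integral_of_le (by positivity),
    integral_poisson_kernel hz]
  · exact ((cont_pk hz).intervalIntegrable 0 (2 * π)).1
  · refine ae_of_all _ fun t => ?_
    have := one_sub_sq_pos hz
    positivity

lemma HD_bound {g : ℝ → ℂ} (hg : Measurable g) {z : ℂ} (hz : ‖z‖ < 1) :
    ENNReal.ofReal (‖HD g z‖ ^ 2 * (1 - ‖z‖ ^ 2)) ≤ ENNReal.ofReal (1 / (2 * π)) *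
      ∫⁻ t in Ioc (0 : ℝ) (2 * π), ENNReal.ofReal (‖g t‖ ^ 2 / ‖ee t - z‖ ^ 2) := by
  have hpos := one_sub_sq_pos hz
  have hpi := Real.pi_pos
  have hm : Measurable fun t => ‖ee t - z‖ :=
    ((continuous_ee.sub continuous_const).norm).measurable
  have h1 : ‖HD g z‖ₑ ≤ ENNReal.ofReal (1 / (2 * π)) *
      ∫⁻ t in Ioc (0 : ℝ) (2 * π), ENNReal.ofReal (‖g t‖ / ‖ee t - z‖) *
        ENNReal.ofReal (1 / ‖ee t - z‖) := by
    unfold HD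
    rw [enorm_mul]
    gcongr
    · rw [← ofReal_norm]
      apply ENNReal.ofReal_le_ofReal
      simp [abs_of_pos hpi]
    · rw [intervalIntegral.integral_of_le (by positivity)]
      refine (enorm_integral_le_lintegral_enorm _).trans (lintegral_mono fun t => ?_)
      rw [← ofReal_norm, ← ENNReal.ofReal_mul (by positivity)]
      apply ENNReal.ofReal_le_ofReal
      rw [norm_mul, norm_div, norm_pow, norm_ee]
      apply le_of_eq
      ring
  have h2 := cs_lintegral (μ := volume.restrict (Ioc (0 : ℝ) (2 * π)))
    (a := fun t => ENNReal.ofReal (‖g t‖ / ‖ee t - z‖))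
    (b := fun t => ENNReal.ofReal (1 / ‖ee t - z‖))
    (by fun_prop) (hm.const_div 1).ennreal_ofReal.aemeasurable
  have e1 : ∀ t, ENNReal.ofReal (‖g t‖ / ‖ee t - z‖) ^ 2
      = ENNReal.ofReal (‖g t‖ ^ 2 / ‖ee t - z‖ ^ 2) := by
    intro t; rw [← ENNReal.ofReal_pow (by positivity), div_pow]
  have e2 : ∀ t, ENNReal.ofReal (1 / ‖ee t - z‖) ^ 2
      = ENNReal.ofReal (1 / ‖ee t - z‖ ^ 2) := by
    intro t; rw [← ENNReal.ofReal_pow (by positivity), div_pow, one_pow]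
  simp_rw [e1, e2] at h2
  have h3 : ENNReal.ofReal (1 - ‖z‖ ^ 2) *
      ∫⁻ t in Ioc (0 : ℝ) (2 * π), ENNReal.ofReal (1 / ‖ee t - z‖ ^ 2) = ENNReal.ofReal (2 * π) := by
    rw [← lintegral_poisson_kernel hz, ← lintegral_const_mul' _ _ ENNReal.ofReal_ne_top]
    congr 1; ext t
    rw [← ENNReal.ofReal_mul hpos.le]
    congr 1; ring
  rw [ENNReal.ofReal_mul (by positivity), ENNReal.ofReal_pow (by positivity), ofReal_norm]
  set A := ∫⁻ t in Ioc (0 : ℝ) (2 * π), ENNReal.ofReal (‖g t‖ ^ 2 / ‖ee t - z‖ ^ 2)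
  set B := ∫⁻ t in Ioc (0 : ℝ) (2 * π), ENNReal.ofReal (1 / ‖ee t - z‖ ^ 2)
  calc ‖HD g z‖ₑ ^ 2 * ENNReal.ofReal (1 - ‖z‖ ^ 2)
      ≤ (ENNReal.ofReal (1 / (2 * π)) * _) ^ 2 * ENNReal.ofReal (1 - ‖z‖ ^ 2) := by
        gcongr
    _ ≤ (ENNReal.ofReal (1 / (2 * π)) ^ 2 * (A * B)) * ENNReal.ofReal (1 - ‖z‖ ^ 2) := by
        rw [mul_pow]; gcongr
    _ = ENNReal.ofReal (1 / (2 * π)) * (ENNReal.ofReal (1 / (2 * π)) *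
          (ENNReal.ofReal (1 - ‖z‖ ^ 2) * B)) * A := by ring
    _ = ENNReal.ofReal (1 / (2 * π)) * A := by
        rw [h3, ← ENNReal.ofReal_mul (by positivity),
          show 1 / (2 * π) * (2 * π) = 1 by field_simp]
        simp

lemma gradSq_bound {f : ℝ → ℂ} (hfm : Measurable f)
    (hf : IntervalIntegrable f volume 0 (2 * π)) {z : ℂ} (hz : ‖z‖ < 1) (c : ℂ) :
    ENNReal.ofReal (gradSq (poissonExt f) z * (1 - ‖z‖ ^ 2)) ≤
      ∫⁻ t in Ioc (0 : ℝ) (2 * π), ENNReal.ofReal (‖f t - c‖ ^ 2 / ‖ee t - z‖ ^ 2) := by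
  have hpos := one_sub_sq_pos hz
  have hcf : Measurable (cf f) := by unfold cf; fun_prop
  rw [gradSq_eq hf hz, HD_sub_const hf hz c,
    HD_sub_const (cf_integrable hf) hz ((starRingEnd ℂ) c)]
  have h1 := HD_bound (g := fun t => f t - c) (by fun_prop) hz
  have h2 := HD_bound (g := fun t => cf f t - (starRingEnd ℂ) c) (by fun_prop) hz
  have e : ∀ t, ‖cf f t - (starRingEnd ℂ) c‖ = ‖f t - c‖ := by
    intro t; unfold cf; rw [← map_sub, Complex.norm_conj]
  simp_rw [e] at h2
  set A := ∫⁻ t in Ioc (0 : ℝ) (2 * π), ENNReal.ofReal (‖f t - c‖ ^ 2 / ‖ee t - z‖ ^ 2)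
  rw [add_mul, ENNReal.ofReal_add (by positivity) (by positivity), mul_assoc, mul_assoc,
    ENNReal.ofReal_mul (p := 2) (by norm_num), ENNReal.ofReal_mul (p := 2) (by norm_num)]
  calc _ ≤ ENNReal.ofReal 2 * (ENNReal.ofReal (1 / (2 * π)) * A) +
        ENNReal.ofReal 2 * (ENNReal.ofReal (1 / (2 * π)) * A) := by gcongr
    _ = ENNReal.ofReal (4 / (2 * π)) * A := by
        rw [← mul_assoc, ← add_mul, ← ENNReal.ofReal_mul (by norm_num),
          ← ENNReal.ofReal_add (by positivity) (by positivity)]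
        congr 2; ring
    _ ≤ 1 * A := by
        gcongr
        rw [ENNReal.ofReal_le_one, div_le_one (by positivity)]
        linarith [Real.pi_gt_three]
    _ = A := one_mul A



lemma ee_add (s t : ℝ) : ee (s + t) = ee s * ee t := by
  unfold ee; rw [← Complex.exp_add]; push_cast; ring_nf

lemma ee_zero : ee 0 = 1 := by simp [ee]

lemma ee_neg_mul (s : ℝ) : ee (-s) * ee s = 1 := by
  rw [← ee_add]; simp [ee_zero]

lemma norm_real_mul_ee {r : ℝ} (hr : 0 ≤ r) (t : ℝ) : ‖(r : ℂ) * ee t‖ = r := by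
  rw [norm_mul, norm_ee, mul_one, Complex.norm_real, Real.norm_of_nonneg hr]

lemma arg_real_mul_ee {r : ℝ} (hr : 0 < r) {t : ℝ} (ht : t ∈ Ioc (-π) π) :
    Complex.arg ((r : ℂ) * ee t) = t := by
  unfold ee
  rw [mul_comm I]
  rw [Complex.exp_mul_I]
  exact Complex.arg_mul_cos_add_sin_mul_I hr ht

lemma carlesonBox_zero {h : ℝ} (hh : h ∈ Ioc (0 : ℝ) 1) :
    carlesonBox 0 h = {z | 1 - h < ‖z‖ ∧ ‖z‖ < 1 ∧ |Complex.arg z| < π * h} := by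
  ext z
  simp only [carlesonBox, mem_ofPred_eq, sub_zero]
  refine and_congr_right fun h1 => and_congr_right fun h2 => ?_
  have hz : 0 < ‖z‖ := by linarith [hh.2]
  have hph : π * h ≤ π := by nlinarith [Real.pi_pos, hh.2]
  constructor
  · rintro ⟨t, ht, hzt⟩
    rw [hzt]
    change |Complex.arg (((‖z‖ : ℝ) : ℂ) * ee t)| < _
    have := abs_lt.1 ht
    rw [arg_real_mul_ee hz ⟨by linarith, by linarith⟩]
    exact ht
  · intro ha
    refine ⟨_, ha, ?_⟩
    rw [mul_comm I]
    exact (Complex.norm_mul_exp_arg_mul_I z).symm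

lemma measurableSet_carlesonBox_zero {h : ℝ} (hh : h ∈ Ioc (0 : ℝ) 1) :
    MeasurableSet (carlesonBox 0 h) := by
  rw [carlesonBox_zero hh]
  have h1 : Measurable fun z : ℂ => ‖z‖ := measurable_norm
  have h2 : Measurable fun z : ℂ => |Complex.arg z| := Complex.measurable_arg.abs
  exact (measurableSet_lt measurable_const h1).inter
    ((measurableSet_lt h1 measurable_const).inter (measurableSet_lt h2 measurable_const))

lemma carlesonBox_preimage (θ h : ℝ) :
    (fun z => ee θ * z) ⁻¹' carlesonBox θ h = carlesonBox 0 h := by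
  ext z
  simp only [carlesonBox, mem_ofPred_eq, mem_preimage, norm_mul, norm_ee, one_mul, sub_zero]
  refine and_congr_right fun h1 => and_congr_right fun h2 => ?_
  constructor
  · rintro ⟨t, ht, hz⟩
    refine ⟨t - θ, ht, ?_⟩
    change z = (‖z‖ : ℂ) * ee (t - θ)
    change ee θ * z = (‖z‖ : ℂ) * ee t at hz
    apply mul_left_cancel₀ (ee_ne_zero θ)
    rw [hz, mul_left_comm, ← ee_add]; congr 2; ring
  · rintro ⟨t, ht, hz⟩
    refine ⟨θ + t, by simpa using ht, ?_⟩
    change ee θ * z = (‖z‖ : ℂ) * ee (θ + t)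
    change z = (‖z‖ : ℂ) * ee t at hz
    rw [ee_add, mul_left_comm, ← hz]

lemma polar_box_zero {h : ℝ} (hh : h ∈ Ioc (0 : ℝ) 1) (W : ℂ → ℝ≥0∞) :
    ∫⁻ z in carlesonBox 0 h, W z =
      ∫⁻ q in Ioo (1 - h) 1 ×ˢ Ioo (-(π * h)) (π * h), ENNReal.ofReal q.1 * W (q.1 * ee q.2) := by
  have hph : π * h ≤ π := by nlinarith [Real.pi_pos, hh.2]
  rw [← lintegral_indicator (measurableSet_carlesonBox_zero hh),
    ← Complex.lintegral_comp_polarCoord_symm]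
  have hsub : Ioo (1 - h) 1 ×ˢ Ioo (-(π * h)) (π * h) ⊆ polarCoord.target := by
    rintro ⟨r, t⟩ ⟨⟨h1, h2⟩, h3, h4⟩
    simp only [polarCoord_target, mem_prod, mem_Ioi, mem_Ioo] at *
    have := hh.2
    refine ⟨by linarith, by linarith, by linarith⟩
  have hms : MeasurableSet (Ioo (1 - h) 1 ×ˢ Ioo (-(π * h)) (π * h)) :=
    measurableSet_Ioo.prod measurableSet_Ioo
  have : ∀ q ∈ polarCoord.target, ENNReal.ofReal q.1 • (carlesonBox 0 h).indicator W
      (Complex.polarCoord.symm q) = (Ioo (1 - h) 1 ×ˢ Ioo (-(π * h)) (π * h)).indicator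
        (fun q => ENNReal.ofReal q.1 * W (q.1 * ee q.2)) q := by
    rintro ⟨r, t⟩ hq
    simp only [polarCoord_target, mem_prod, mem_Ioi, mem_Ioo] at hq
    have e1 : Complex.polarCoord.symm (r, t) = (r : ℂ) * ee t := by
      rw [Complex.polarCoord_symm_apply]
      unfold ee; rw [mul_comm I, Complex.exp_mul_I]; simp
    have e2 : (r : ℂ) * ee t ∈ carlesonBox 0 h ↔
        (r, t) ∈ Ioo (1 - h) 1 ×ˢ Ioo (-(π * h)) (π * h) := by
      rw [carlesonBox_zero hh]
      simp only [mem_ofPred_eq, norm_real_mul_ee hq.1.le,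
        arg_real_mul_ee hq.1 ⟨hq.2.1, hq.2.2.le⟩, mem_prod, mem_Ioo, abs_lt, and_assoc]
    rw [e1, smul_eq_mul]
    by_cases hm : (r, t) ∈ Ioo (1 - h) 1 ×ˢ Ioo (-(π * h)) (π * h)
    · rw [indicator_of_mem (e2.2 hm), indicator_of_mem hm]
    · rw [indicator_of_notMem (fun h' => hm (e2.1 h')), indicator_of_notMem hm, mul_zero]
  rw [setLIntegral_congr_fun polarCoord.open_target.measurableSet this,
    setLIntegral_indicator hms, inter_eq_self_of_subset_left hsub]

lemma polar_box {h : ℝ} (hh : h ∈ Ioc (0 : ℝ) 1) (θ : ℝ) {W : ℂ → ℝ≥0∞} (hW : Measurable W) :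
    ∫⁻ z in carlesonBox θ h, W z =
      ∫⁻ t in arcInterval θ h, ∫⁻ r in Ioo (1 - h) 1, ENNReal.ofReal r * W (r * ee t) := by
  have hmp : MeasurePreserving (fun z : ℂ => ee θ * z) volume volume := by
    have := (rotation ⟨ee θ, by simp [Submonoid.unitSphere, norm_ee]⟩).measurePreserving
    exact this
  have hemb : MeasurableEmbedding (fun z : ℂ => ee θ * z) :=
    (Homeomorph.mulLeft₀ (ee θ) (ee_ne_zero θ)).measurableEmbedding
  rw [← hmp.setLIntegral_comp_preimage_emb hemb, carlesonBox_preimage, polar_box_zero hh]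
  have hce := continuous_ee.measurable
  rw [Measure.volume_eq_prod, ← Measure.prod_restrict, lintegral_prod_symm']
  · have hmp2 : MeasurePreserving (fun t : ℝ => θ + t) volume volume :=
      measurePreserving_add_left volume θ
    have hemb2 : MeasurableEmbedding (fun t : ℝ => θ + t) :=
      (Homeomorph.addLeft θ).measurableEmbedding
    rw [← hmp2.setLIntegral_comp_preimage_emb hemb2 _ (arcInterval θ h)]
    have : (fun t : ℝ => θ + t) ⁻¹' arcInterval θ h = Ioo (-(π * h)) (π * h) := by
      ext t; simp only [arcInterval, mem_preimage, mem_Ioo]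
      constructor <;> rintro ⟨h1, h2⟩ <;> constructor <;> linarith
    rw [this]
    simp only [ee_add]
    congr 1; ext t; congr 1; ext r; congr 2; ring
  · fun_prop


lemma lint_Ioc_rpow {q a : ℝ} (hq : -1 < q) (ha : 0 ≤ a) :
    ∫⁻ x in Ioc 0 a, ENNReal.ofReal (x ^ q) = ENNReal.ofReal (a ^ (q + 1) / (q + 1)) := by
  rw [← ofReal_integral_eq_lintegral_ofReal, ← intervalIntegral.integral_of_le ha,
    integral_rpow (Or.inl hq), Real.zero_rpow (by linarith), sub_zero]
  · exact (intervalIntegral.intervalIntegrable_rpow' hq).1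
  · refine (ae_restrict_iff' measurableSet_Ioc).2 (ae_of_all _ fun x hx => ?_)
    exact Real.rpow_nonneg hx.1.le q

lemma lint_Ioi_rpow {q a : ℝ} (hq : q < -1) (ha : 0 < a) :
    ∫⁻ x in Ioi a, ENNReal.ofReal (x ^ q) = ENNReal.ofReal (a ^ (q + 1) / (-(q + 1))) := by
  rw [← ofReal_integral_eq_lintegral_ofReal, integral_Ioi_rpow_of_lt hq ha]
  · congr 1; rw [div_neg, neg_div]
  · exact integrableOn_Ioi_rpow_of_lt hq ha
  · refine (ae_restrict_iff' measurableSet_Ioi).2 (ae_of_all _ fun x hx => ?_)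
    exact Real.rpow_nonneg (ha.le.trans (le_of_lt hx)) q

lemma chord_eq (s t : ℝ) : ‖ee s - ee t‖ = 2 * |Real.sin ((s - t) / 2)| := by
  have h : ee s - ee t = ee t * (Complex.exp (I * ((s - t : ℝ) : ℂ)) - 1) := by
    have : ee s = ee t * ee (s - t) := by rw [← ee_add]; congr 1; ring
    rw [this]; unfold ee; ring
  rw [h, norm_mul, norm_ee, one_mul, Complex.norm_exp_I_mul_ofReal_sub_one]
  simp

lemma chord_le (s t : ℝ) : ‖ee s - ee t‖ ≤ |s - t| := by
  rw [chord_eq]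
  have := Real.abs_sin_le_abs (x := (s - t) / 2)
  rw [abs_div, abs_two] at this
  linarith

lemma chord_ge {s t : ℝ} (h : |s - t| ≤ 3 * π / 2) : |s - t| / 5 ≤ ‖ee s - ee t‖ := by
  rw [chord_eq]
  have hpi := Real.pi_gt_three
  have hpi4 := Real.pi_lt_four
  have e : |Real.sin ((s - t) / 2)| = |Real.sin (|s - t| / 2)| := by
    rcases abs_cases (s - t) with ⟨h1, _⟩ | ⟨h1, _⟩
    · rw [h1]
    · rw [h1, neg_div, Real.sin_neg, abs_neg]
  rw [e]
  set x := |s - t| with hx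
  have hx0 : 0 ≤ x := abs_nonneg _
  by_cases hc : x / 2 ≤ π / 2
  · have h1 := Real.mul_le_sin (x := x / 2) (by positivity) hc
    have h2 : x / 10 ≤ 2 / π * (x / 2) := by
      rw [div_mul_div_comm, div_le_div_iff₀ (by norm_num) (by positivity)]
      nlinarith
    have := le_abs_self (Real.sin (x / 2))
    linarith
  · push Not at hc
    have h1 := Real.mul_le_sin (x := π - x / 2) (by linarith) (by linarith)
    rw [Real.sin_pi_sub] at h1
    have h2 : 1 / 2 ≤ 2 / π * (π - x / 2) := by
      rw [div_mul_eq_mul_div, le_div_iff₀ (by positivity)]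
      linarith
    have := le_abs_self (Real.sin (x / 2))
    have := Real.pi_lt_d2
    linarith

lemma chord_ge' {s t : ℝ} (h : |s - t| ≤ π) : |s - t| / 5 ≤ ‖ee s - ee t‖ :=
  chord_ge (by linarith [Real.pi_pos])

lemma eq_of_ee_eq {f : ℝ → ℂ} (hper : Function.Periodic f (2 * π)) {s t : ℝ}
    (h : ‖ee s - ee t‖ = 0) : f s = f t := by
  rw [norm_eq_zero, sub_eq_zero] at h
  unfold ee at h
  rw [Complex.exp_eq_exp_iff_exists_int] at h
  obtain ⟨n, hn⟩ := h
  have h1 : I * (s : ℂ) = I * ((t + n * (2 * π) : ℝ) : ℂ) := by rw [hn]; push_cast; ring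
  have h2 := Complex.ofReal_injective (mul_left_cancel₀ I_ne_zero h1)
  rw [h2]
  exact hper.int_mul n t

lemma per_lint {g : ℝ → ℝ≥0∞} (hg : Function.Periodic g (2 * π)) (a b : ℝ) :
    ∫⁻ x in Ioc a (a + 2 * π), g x = ∫⁻ x in Ioc b (b + 2 * π), g x := by
  have h2 : (0 : ℝ) < 2 * π := by positivity
  refine (isAddFundamentalDomain_Ioc h2 a).setLIntegral_eq (isAddFundamentalDomain_Ioc h2 b) g ?_
  rintro ⟨_, ⟨n, rfl⟩⟩ x
  change g ((n • (2 * π)) + x) = g x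
  rw [add_comm]
  exact hg.zsmul n x

lemma lint_arc_one {g : ℝ → ℝ≥0∞} (hg : Function.Periodic g (2 * π)) (θ b : ℝ) :
    ∫⁻ x in arcInterval θ 1, g x = ∫⁻ x in Ioc b (b + 2 * π), g x := by
  unfold arcInterval
  rw [per_lint hg b (θ - π * 1), show θ + π * 1 = θ - π * 1 + 2 * π by ring]
  exact setLIntegral_congr Ioo_ae_eq_Ioc

lemma arc_mono (θ : ℝ) {h k : ℝ} (hk : h ≤ k) : arcInterval θ h ⊆ arcInterval θ k := by
  unfold arcInterval
  have := Real.pi_pos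
  apply Ioo_subset_Ioo <;> nlinarith

lemma measurableSet_arc (θ h : ℝ) : MeasurableSet (arcInterval θ h) := measurableSet_Ioo

lemma mem_arc {θ h t : ℝ} : t ∈ arcInterval θ h ↔ |t - θ| < π * h := by
  unfold arcInterval
  rw [mem_Ioo, abs_lt]
  constructor <;> rintro ⟨h1, h2⟩ <;> constructor <;> linarith

lemma volume_arc (θ h : ℝ) : volume (arcInterval θ h) = ENNReal.ofReal (2 * π * h) := by
  unfold arcInterval; rw [Real.volume_Ioo]; congr 1; ring

/-- the density -/
def dens (p : ℝ) (f : ℝ → ℂ) (z : ℂ) : ℝ := gradSq (poissonExt f) z * (1 - ‖z‖ ^ 2) ^ p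

lemma measurable_dens (p : ℝ) (f : ℝ → ℂ) : Measurable (dens p f) := by
  unfold dens
  have := measurable_gradSq (poissonExt f)
  fun_prop

lemma lint_one_sub (g : ℝ → ℝ≥0∞) (h : ℝ) :
    ∫⁻ r in Ioo (1 - h) 1, g r = ∫⁻ δ in Ioo 0 h, g (1 - δ) := by
  have hmp : MeasurePreserving (fun δ : ℝ => 1 - δ) volume volume :=
    Measure.measurePreserving_sub_left volume 1
  have hemb : MeasurableEmbedding (fun δ : ℝ => 1 - δ) :=
    (Homeomorph.subLeft 1).measurableEmbedding
  rw [← hmp.setLIntegral_comp_preimage_emb hemb]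
  congr 2
  ext x; simp only [mem_preimage, mem_Ioo]
  constructor <;> rintro ⟨h1, h2⟩ <;> constructor <;> linarith

lemma box_measure (p : ℝ) (f : ℝ → ℂ) (θ : ℝ) {h : ℝ} (hh : h ∈ Ioc (0 : ℝ) 1) :
    diskMeasure (dens p f) (carlesonBox θ h) =
      ∫⁻ t in arcInterval θ h, ∫⁻ δ in Ioo 0 h,
        ENNReal.ofReal (1 - δ) * ENNReal.ofReal (dens p f (((1 - δ : ℝ) : ℂ) * ee t)) := by
  have hsub : carlesonBox θ h ⊆ unitDisk := by
    intro z hz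
    simp only [unitDisk, mem_ball, dist_zero_right]
    exact hz.2.1
  unfold diskMeasure
  rw [withDensity_apply', Measure.restrict_restrict_of_subset hsub,
    polar_box hh θ (measurable_dens p f).ennreal_ofReal]
  congr 1; ext t
  rw [lint_one_sub]

lemma box_upper {p : ℝ} (hp1 : p < 1) (f : ℝ → ℂ) (θ : ℝ) {h : ℝ} (hh : h ∈ Ioc (0 : ℝ) 1) :
    diskMeasure (dens p f) (carlesonBox θ h) ≤
      ∫⁻ t in arcInterval θ h, ∫⁻ δ in Ioo 0 h, ENNReal.ofReal (δ ^ (p - 1)) *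
        ENNReal.ofReal (gradSq (poissonExt f) (((1 - δ : ℝ) : ℂ) * ee t) *
          (1 - ‖((1 - δ : ℝ) : ℂ) * ee t‖ ^ 2)) := by
  rw [box_measure p f θ hh]
  refine lintegral_mono fun t => setLIntegral_mono' measurableSet_Ioo fun δ hδ => ?_
  have hd : δ < 1 := hδ.2.trans_le hh.2
  have hd0 := hδ.1
  rw [← ENNReal.ofReal_mul (by linarith), ← ENNReal.ofReal_mul (Real.rpow_nonneg hδ.1.le _)]
  apply ENNReal.ofReal_le_ofReal
  unfold dens
  rw [norm_real_mul_ee (by linarith)]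
  have hG := gradSq_nonneg (poissonExt f) (((1 - δ : ℝ) : ℂ) * ee t)
  set G := gradSq (poissonExt f) (((1 - δ : ℝ) : ℂ) * ee t)
  have hx : δ ≤ 1 - (1 - δ) ^ 2 := by nlinarith
  have hx0 : 0 < 1 - (1 - δ) ^ 2 := by linarith
  have h1 : (1 - (1 - δ) ^ 2) ^ p = (1 - (1 - δ) ^ 2) ^ (p - 1) * (1 - (1 - δ) ^ 2) := by
    rw [← Real.rpow_add_one hx0.ne']; congr 1; ring
  have h2 : (1 - (1 - δ) ^ 2) ^ (p - 1) ≤ δ ^ (p - 1) :=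
    Real.rpow_le_rpow_of_nonpos hd0 hx (by linarith)
  rw [h1]
  have h3 : 0 ≤ (1 - (1 - δ) ^ 2) ^ (p - 1) := Real.rpow_nonneg hx0.le _
  calc (1 - δ) * (G * ((1 - (1 - δ) ^ 2) ^ (p - 1) * (1 - (1 - δ) ^ 2)))
      ≤ 1 * (G * (δ ^ (p - 1) * (1 - (1 - δ) ^ 2))) := by
        gcongr
        linarith
    _ = _ := by ring

lemma box_lower {p : ℝ} (hp0 : 0 < p) (f : ℝ → ℂ) (θ : ℝ) {h : ℝ} (hh : h ∈ Ioc (0 : ℝ) 1) :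
    ∫⁻ t in arcInterval θ h, ∫⁻ δ in Ioo 0 (h / 2),
        ENNReal.ofReal (gradSq (poissonExt f) (((1 - δ : ℝ) : ℂ) * ee t)) * ENNReal.ofReal (δ ^ p)
      ≤ 2 * diskMeasure (dens p f) (carlesonBox θ h) := by
  rw [box_measure p f θ hh, ← lintegral_const_mul' _ _ (by norm_num)]
  refine lintegral_mono fun t => ?_
  rw [← lintegral_const_mul' _ _ (by norm_num)]
  have hh1 := hh.1
  have hh2 := hh.2
  refine (setLIntegral_mono' measurableSet_Ioo fun δ hδ => ?_).trans
    (lintegral_mono_set (Ioo_subset_Ioo_right (by linarith)))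
  have hd : δ < 1 / 2 := by linarith [hδ.2]
  have hd0 := hδ.1
  have e2 : (2 : ℝ≥0∞) = ENNReal.ofReal 2 := by simp
  have hG := gradSq_nonneg (poissonExt f) (((1 - δ : ℝ) : ℂ) * ee t)
  rw [e2, ← ENNReal.ofReal_mul (p := 1 - δ) (by linarith),
    ← ENNReal.ofReal_mul (p := 2) (by norm_num), ← ENNReal.ofReal_mul hG]
  apply ENNReal.ofReal_le_ofReal
  unfold dens
  rw [norm_real_mul_ee (by linarith)]
  set G := gradSq (poissonExt f) (((1 - δ : ℝ) : ℂ) * ee t)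
  have hx : δ ≤ 1 - (1 - δ) ^ 2 := by nlinarith
  have h2 : δ ^ p ≤ (1 - (1 - δ) ^ 2) ^ p := Real.rpow_le_rpow hd0.le hx hp0.le
  have h3 : 0 ≤ δ ^ p := Real.rpow_nonneg hd0.le _
  calc G * δ ^ p ≤ G * (1 - (1 - δ) ^ 2) ^ p := by gcongr
    _ = 1 * (G * (1 - (1 - δ) ^ 2) ^ p) := by ring
    _ ≤ (2 * (1 - δ)) * (G * (1 - (1 - δ) ^ 2) ^ p) := by
        gcongr
        · exact mul_nonneg hG (h3.trans h2)
        · linarith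
    _ = _ := by ring



lemma intervalIntegrable_of_l2 {f : ℝ → ℂ} (hfm : Measurable f) (hfL2 : l2Circle f < ⊤) :
    IntervalIntegrable f volume 0 (2 * π) := by
  rw [intervalIntegrable_iff_integrableOn_Ioc_of_le (by positivity)]
  have h : MemLp f 2 (volume.restrict (Ioc 0 (2 * π))) := by
    refine ⟨hfm.aestronglyMeasurable, ?_⟩
    rw [eLpNorm_lt_top_iff_lintegral_rpow_enorm_lt_top (by norm_num) (by norm_num)]
    unfold l2Circle at hfL2
    refine lt_of_eq_of_lt (lintegral_congr fun a => ?_) hfL2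
    rw [enorm_eq_nnnorm]; norm_num
  exact h.integrable (by norm_num)

lemma kernel_lower {δ : ℝ} (hδ : δ ∈ Ioo (0 : ℝ) 1) (s t : ℝ) :
    δ ≤ ‖ee t - ((1 - δ : ℝ) : ℂ) * ee s‖ ∧
      ‖ee t - ee s‖ / 2 ≤ ‖ee t - ((1 - δ : ℝ) : ℂ) * ee s‖ := by
  have h1 := ee_sub_lower t (((1 - δ : ℝ) : ℂ) * ee s)
  rw [norm_real_mul_ee (by linarith [hδ.2])] at h1
  have h1' : δ ≤ ‖ee t - ((1 - δ : ℝ) : ℂ) * ee s‖ := by linarith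
  refine ⟨h1', ?_⟩
  have h2 : ee t - ee s = (ee t - ((1 - δ : ℝ) : ℂ) * ee s) - (δ : ℂ) * ee s := by
    push_cast; ring
  have h3 := norm_sub_le (ee t - ((1 - δ : ℝ) : ℂ) * ee s) ((δ : ℂ) * ee s)
  rw [← h2, norm_real_mul_ee hδ.1.le] at h3
  linarith

lemma near_kernel {p : ℝ} (hp0 : 0 < p) (hp1 : p < 1) (s t X : ℝ)
    (hX : ‖ee t - ee s‖ = 0 → X = 0) :
    ∫⁻ δ in Ioo (0 : ℝ) 1, ENNReal.ofReal (δ ^ (p - 1)) *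
        ENNReal.ofReal (X ^ 2 / ‖ee t - ((1 - δ : ℝ) : ℂ) * ee s‖ ^ 2)
      ≤ ENNReal.ofReal (4 * (1 / p + 1 / (2 - p))) *
        ENNReal.ofReal (X ^ 2 / ‖ee t - ee s‖ ^ (2 - p)) := by
  by_cases hd : ‖ee t - ee s‖ = 0
  · simp [hX hd]
  have hd0 : 0 < ‖ee t - ee s‖ := lt_of_le_of_ne (norm_nonneg _) (Ne.symm hd)
  set d := ‖ee t - ee s‖ with hdd
  have hb0 : 0 < d / 2 := by positivity
  set b := d / 2 with hb
  have hsub : Ioo (0 : ℝ) 1 = (Ioo (0 : ℝ) 1 ∩ Ioc 0 b) ∪ (Ioo (0 : ℝ) 1 ∩ Ioi b) := by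
    rw [← inter_union_distrib_left, Ioc_union_Ioi_eq_Ioi hb0.le]
    ext x; simp only [mem_Ioo, mem_inter_iff, mem_Ioi]; tauto
  rw [hsub]
  refine (lintegral_union_le _ _ _).trans ?_
  have h1 : ∫⁻ δ in Ioo (0 : ℝ) 1 ∩ Ioc 0 b, ENNReal.ofReal (δ ^ (p - 1)) *
        ENNReal.ofReal (X ^ 2 / ‖ee t - ((1 - δ : ℝ) : ℂ) * ee s‖ ^ 2)
        ≤ ENNReal.ofReal (b ^ p / p) * ENNReal.ofReal (X ^ 2 / b ^ 2) := by
    have := lint_Ioc_rpow (q := p - 1) (a := b) (by linarith) hb0.le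
    rw [show p - 1 + 1 = p by ring] at this
    rw [← this, ← lintegral_mul_const' _ _ ENNReal.ofReal_ne_top]
    refine (setLIntegral_mono' (measurableSet_Ioo.inter measurableSet_Ioc) fun δ hδ => ?_).trans
      (lintegral_mono_set inter_subset_right)
    gcongr
    exact (kernel_lower hδ.1 s t).2
  have h2 : ∫⁻ δ in Ioo (0 : ℝ) 1 ∩ Ioi b, ENNReal.ofReal (δ ^ (p - 1)) *
        ENNReal.ofReal (X ^ 2 / ‖ee t - ((1 - δ : ℝ) : ℂ) * ee s‖ ^ 2)
        ≤ ENNReal.ofReal (b ^ (p - 2) / (2 - p)) * ENNReal.ofReal (X ^ 2) := by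
    have := lint_Ioi_rpow (q := p - 3) (a := b) (by linarith) hb0
    rw [show p - 3 + 1 = p - 2 by ring, neg_sub] at this
    rw [← this, ← lintegral_mul_const' _ _ ENNReal.ofReal_ne_top]
    refine (setLIntegral_mono' (measurableSet_Ioo.inter measurableSet_Ioi) fun δ hδ => ?_).trans
      (lintegral_mono_set inter_subset_right)
    have hδ0 : 0 < δ := hδ.1.1
    rw [← ENNReal.ofReal_mul (by positivity), ← ENNReal.ofReal_mul (by positivity)]
    apply ENNReal.ofReal_le_ofReal
    have e : δ ^ (p - 3) = δ ^ (p - 1) / δ ^ 2 := by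
      rw [show p - 3 = p - 1 - 2 by ring, Real.rpow_sub hδ0, Real.rpow_two]
    rw [e, div_mul_eq_mul_div, mul_div_assoc]
    gcongr
    exact (kernel_lower hδ.1 s t).1
  refine (add_le_add h1 h2).trans ?_
  have h2p : 0 < 2 - p := by linarith
  rw [← ENNReal.ofReal_mul (by positivity), ← ENNReal.ofReal_mul (by positivity),
    ← ENNReal.ofReal_mul (by positivity), ← ENNReal.ofReal_add (by positivity) (by positivity)]
  apply ENNReal.ofReal_le_ofReal
  have e1 : b ^ p / b ^ 2 = b ^ (p - 2) := by rw [Real.rpow_sub hb0, Real.rpow_two]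
  have e2 : b ^ (p - 2) ≤ 4 * (1 / d ^ (2 - p)) := by
    rw [hb, Real.div_rpow hd0.le (by norm_num), show p - 2 = -(2 - p) by ring,
      Real.rpow_neg hd0.le, Real.rpow_neg (by norm_num)]
    rw [div_inv_eq_mul, mul_comm, one_div]
    gcongr
    calc (2 : ℝ) ^ (2 - p) ≤ 2 ^ (2 : ℝ) := by
          apply Real.rpow_le_rpow_of_exponent_le <;> linarith
      _ = 4 := by norm_num
  calc b ^ p / p * (X ^ 2 / b ^ 2) + b ^ (p - 2) / (2 - p) * X ^ 2
      = (b ^ p / b ^ 2) * X ^ 2 * (1 / p) + b ^ (p - 2) * X ^ 2 * (1 / (2 - p)) := by ring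
    _ = b ^ (p - 2) * (X ^ 2 * (1 / p + 1 / (2 - p))) := by rw [e1]; ring
    _ ≤ 4 * (1 / d ^ (2 - p)) * (X ^ 2 * (1 / p + 1 / (2 - p))) := by gcongr
    _ = _ := by ring

lemma osc_bound {p C : ℝ} (hp0 : 0 < p) (hp1 : p < 1) (hC : 0 ≤ C) {f : ℝ → ℂ}
    (hfper : Function.Periodic f (2 * π)) (θ : ℝ) {h : ℝ} (hh : h ∈ Ioc (0 : ℝ) 1)
    (hQ : qpTDouble p f θ h ≤ ENNReal.ofReal (C * h ^ p)) :
    ∫⁻ s in arcInterval θ h, ∫⁻ t in arcInterval θ h, ENNReal.ofReal (‖f s - f t‖ ^ 2)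
      ≤ ENNReal.ofReal (C * (2 * π) ^ 2 * h ^ 2) := by
  have hh0 := hh.1
  have hpi := Real.pi_gt_three
  calc _ ≤ ENNReal.ofReal ((2 * π * h) ^ (2 - p)) * qpTDouble p f θ h := by
        unfold qpTDouble
        rw [← lintegral_const_mul' _ _ ENNReal.ofReal_ne_top]
        refine setLIntegral_mono' (measurableSet_arc _ _) fun s hs => ?_
        rw [← lintegral_const_mul' _ _ ENNReal.ofReal_ne_top]
        refine setLIntegral_mono' (measurableSet_arc _ _) fun t ht => ?_
        rw [← ENNReal.ofReal_mul (by positivity)]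
        apply ENNReal.ofReal_le_ofReal
        change _ ≤ (2 * π * h) ^ (2 - p) * (‖f s - f t‖ ^ 2 / ‖ee s - ee t‖ ^ (2 - p))
        by_cases hd : ‖ee s - ee t‖ = 0
        · rw [eq_of_ee_eq hfper hd]; simp
        have hd0 : 0 < ‖ee s - ee t‖ := lt_of_le_of_ne (norm_nonneg _) (Ne.symm hd)
        have h1 : ‖ee s - ee t‖ ≤ 2 * π * h := by
          refine (chord_le s t).trans ?_
          rw [mem_arc] at hs ht
          have := abs_sub_le s θ t
          rw [abs_sub_comm θ t] at this
          linarith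
        have h2 : ‖ee s - ee t‖ ^ (2 - p) ≤ (2 * π * h) ^ (2 - p) :=
          Real.rpow_le_rpow hd0.le h1 (by linarith)
        have h3 : 0 < ‖ee s - ee t‖ ^ (2 - p) := Real.rpow_pos_of_pos hd0 _
        rw [mul_div_assoc', le_div_iff₀ h3, mul_comm]
        gcongr
    _ ≤ ENNReal.ofReal ((2 * π * h) ^ (2 - p)) * ENNReal.ofReal (C * h ^ p) := by gcongr
    _ ≤ _ := by
        rw [← ENNReal.ofReal_mul (by positivity)]
        apply ENNReal.ofReal_le_ofReal
        rw [Real.mul_rpow (by positivity) hh0.le]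
        have e : h ^ (2 - p) * h ^ p = h ^ 2 := by
          rw [← Real.rpow_add hh0, ← Real.rpow_two]; congr 1; ring
        have e2 : (2 * π) ^ (2 - p) ≤ (2 * π) ^ 2 := by
          rw [← Real.rpow_two]
          apply Real.rpow_le_rpow_of_exponent_le <;> linarith
        calc (2 * π) ^ (2 - p) * h ^ (2 - p) * (C * h ^ p)
            = (2 * π) ^ (2 - p) * C * (h ^ (2 - p) * h ^ p) := by ring
          _ ≤ (2 * π) ^ 2 * C * h ^ 2 := by rw [e]; gcongr
          _ = _ := by ring

lemma lint_inv_sq (θ : ℝ) {a : ℝ} (ha : 0 < a) :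
    ∫⁻ t in {t : ℝ | a ≤ |t - θ|}, ENNReal.ofReal (1 / (t - θ) ^ 2) ≤ ENNReal.ofReal (2 / a) := by
  have base : ∫⁻ x in Ioi a, ENNReal.ofReal (1 / x ^ 2) = ENNReal.ofReal (1 / a) := by
    have := lint_Ioi_rpow (q := -2) (a := a) (by norm_num) ha
    rw [show (-2 : ℝ) + 1 = -1 by norm_num, neg_neg, Real.rpow_neg_one, div_one, ← one_div] at this
    rw [← this]
    refine setLIntegral_congr_fun measurableSet_Ioi fun x hx => ?_
    have : 0 < x := ha.trans hx
    rw [Real.rpow_neg this.le, Real.rpow_two, one_div]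
  have r1 : ∫⁻ t in Ioi (θ + a), ENNReal.ofReal (1 / (t - θ) ^ 2) = ENNReal.ofReal (1 / a) := by
    rw [← base]
    have hmp : MeasurePreserving (fun t : ℝ => t - θ) volume volume :=
      measurePreserving_sub_right volume θ
    have hemb : MeasurableEmbedding (fun t : ℝ => t - θ) :=
      (Homeomorph.subRight θ).measurableEmbedding
    rw [← hmp.setLIntegral_comp_preimage_emb hemb _ (Ioi a)]
    congr 2
    ext x; simp only [mem_preimage, mem_Ioi]; constructor <;> intro _ <;> linarith
  have r2 : ∫⁻ t in Iio (θ - a), ENNReal.ofReal (1 / (t - θ) ^ 2) = ENNReal.ofReal (1 / a) := by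
    rw [← base]
    have hmp : MeasurePreserving (fun t : ℝ => θ - t) volume volume :=
      Measure.measurePreserving_sub_left volume θ
    have hemb : MeasurableEmbedding (fun t : ℝ => θ - t) :=
      (Homeomorph.subLeft θ).measurableEmbedding
    rw [← hmp.setLIntegral_comp_preimage_emb hemb _ (Ioi a)]
    have : (fun t : ℝ => θ - t) ⁻¹' Ioi a = Iio (θ - a) := by
      ext x; simp only [mem_preimage, mem_Ioi, mem_Iio]; constructor <;> intro _ <;> linarith
    rw [this]
    congr 1; ext x; congr 2; ring
  calc _ ≤ ∫⁻ t in Ici (θ + a) ∪ Iic (θ - a), ENNReal.ofReal (1 / (t - θ) ^ 2) := by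
        refine lintegral_mono_set fun t ht => ?_
        have ht' : a ≤ |t - θ| := ht
        rcases le_abs.1 ht' with h | h
        · left; simp only [mem_Ici]; linarith
        · right; simp only [mem_Iic]; linarith
    _ ≤ _ := lintegral_union_le _ _ _
    _ = ENNReal.ofReal (1 / a) + ENNReal.ofReal (1 / a) := by
        rw [setLIntegral_congr Ioi_ae_eq_Ici.symm, setLIntegral_congr Iio_ae_eq_Iic.symm, r1, r2]
    _ = _ := by
        rw [← ENNReal.ofReal_add (by positivity) (by positivity)]; congr 1; ring


/-- The far-away part of the oscillation. -/
def farV (f : ℝ → ℂ) (θ h : ℝ) : ℝ≥0∞ :=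
  ∫⁻ s in arcInterval θ h, ∫⁻ t in arcInterval θ 1 \ arcInterval θ (2 * h),
    ENNReal.ofReal (‖f t - f s‖ ^ 2 / (t - θ) ^ 2)

lemma not_mem_arc {θ h t : ℝ} (ht : t ∉ arcInterval θ h) : π * h ≤ |t - θ| := by
  rw [mem_arc] at ht; linarith

lemma far_piece {OC : ℝ} (hOC : 0 ≤ OC) (f : ℝ → ℂ) (θ : ℝ) {h k : ℝ} (hh : 0 < h) (hk : h ≤ k)
    (hk4 : k ≤ 4 * h)
    (hO : ∫⁻ s in arcInterval θ k, ∫⁻ t in arcInterval θ k, ENNReal.ofReal (‖f s - f t‖ ^ 2)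
      ≤ ENNReal.ofReal (OC * k ^ 2)) :
    ∫⁻ s in arcInterval θ h, ∫⁻ t in arcInterval θ k \ arcInterval θ (2 * h),
      ENNReal.ofReal (‖f t - f s‖ ^ 2 / (t - θ) ^ 2) ≤ ENNReal.ofReal OC := by
  have hpi := Real.pi_gt_three
  have hk0 : 0 < k := by linarith
  calc _ ≤ ENNReal.ofReal (1 / (2 * π * h) ^ 2) * ∫⁻ s in arcInterval θ k,
        ∫⁻ t in arcInterval θ k, ENNReal.ofReal (‖f s - f t‖ ^ 2) := by
        rw [← lintegral_const_mul' _ _ ENNReal.ofReal_ne_top]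
        refine (lintegral_mono_set (arc_mono θ hk)).trans ?_
        refine lintegral_mono fun s => ?_
        rw [← lintegral_const_mul' _ _ ENNReal.ofReal_ne_top]
        refine (setLIntegral_mono' ((measurableSet_arc _ _).diff (measurableSet_arc _ _))
          fun t ht => ?_).trans (lintegral_mono_set sdiff_subset)
        have h1 := not_mem_arc ht.2
        rw [← ENNReal.ofReal_mul (by positivity)]
        apply ENNReal.ofReal_le_ofReal
        rw [norm_sub_rev, one_div, inv_mul_eq_div, ← sq_abs (t - θ)]
        gcongr
        linarith
    _ ≤ ENNReal.ofReal (1 / (2 * π * h) ^ 2) * ENNReal.ofReal (OC * k ^ 2) := by gcongr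
    _ ≤ _ := by
        rw [← ENNReal.ofReal_mul (by positivity)]
        apply ENNReal.ofReal_le_ofReal
        rw [one_div, inv_mul_eq_div, div_le_iff₀ (by positivity)]
        gcongr
        nlinarith

lemma far_step {OC : ℝ} (hOC : 0 ≤ OC) {f : ℝ → ℂ} (hfm : Measurable f) (θ : ℝ) {h : ℝ}
    (hh : 0 < h)
    (hO : ∫⁻ s in arcInterval θ (2 * h), ∫⁻ t in arcInterval θ (2 * h),
      ENNReal.ofReal (‖f s - f t‖ ^ 2) ≤ ENNReal.ofReal (OC * (2 * h) ^ 2))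
    (hV : farV f θ (2 * h) ≤ ENNReal.ofReal (8 * OC)) :
    ∫⁻ s in arcInterval θ h, ∫⁻ t in arcInterval θ 1 \ arcInterval θ (2 * (2 * h)),
      ENNReal.ofReal (‖f t - f s‖ ^ 2 / (t - θ) ^ 2) ≤ ENNReal.ofReal (7 * OC) := by
  have hpi := Real.pi_gt_three
  set S := arcInterval θ 1 \ arcInterval θ (2 * (2 * h)) with hS
  have hSm : MeasurableSet S := (measurableSet_arc _ _).diff (measurableSet_arc _ _)
  have key : ENNReal.ofReal (2 * π * (2 * h)) * ∫⁻ s in arcInterval θ h, ∫⁻ t in S,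
      ENNReal.ofReal (‖f t - f s‖ ^ 2 / (t - θ) ^ 2) ≤
      ENNReal.ofReal (2 * π * (2 * h)) * ENNReal.ofReal (7 * OC) := by
    calc _ = ∫⁻ s in arcInterval θ h, ∫⁻ t in S, ∫⁻ s' in arcInterval θ (2 * h),
          ENNReal.ofReal (‖f t - f s‖ ^ 2 / (t - θ) ^ 2) := by
          rw [← lintegral_const_mul' _ _ ENNReal.ofReal_ne_top]
          refine lintegral_congr fun s => ?_
          rw [← lintegral_const_mul' _ _ ENNReal.ofReal_ne_top]
          refine lintegral_congr fun t => ?_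
          rw [setLIntegral_const, volume_arc, mul_comm]
      _ ≤ ∫⁻ s in arcInterval θ h, ∫⁻ t in S, ∫⁻ s' in arcInterval θ (2 * h),
          (ENNReal.ofReal (3 / 2) * ENNReal.ofReal (‖f t - f s'‖ ^ 2 / (t - θ) ^ 2) +
          ENNReal.ofReal 3 * (ENNReal.ofReal (‖f s - f s'‖ ^ 2) *
            ENNReal.ofReal (1 / (t - θ) ^ 2))) := by
          gcongr with s t s'
          rw [← ENNReal.ofReal_mul (by positivity), ← ENNReal.ofReal_mul (by positivity),
            ← ENNReal.ofReal_mul (by positivity), ← ENNReal.ofReal_add (by positivity)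
            (by positivity)]
          apply ENNReal.ofReal_le_ofReal
          have h1 : ‖f t - f s‖ ≤ ‖f t - f s'‖ + ‖f s - f s'‖ := by
            rw [norm_sub_rev (f s)]
            exact norm_sub_le_norm_sub_add_norm_sub _ _ _
          have h2 : ‖f t - f s‖ ^ 2 ≤ 3 / 2 * ‖f t - f s'‖ ^ 2 + 3 * ‖f s - f s'‖ ^ 2 := by
            have : ‖f t - f s‖ ^ 2 ≤ (‖f t - f s'‖ + ‖f s - f s'‖) ^ 2 := by gcongr
            nlinarith [sq_nonneg (‖f t - f s'‖ - 2 * ‖f s - f s'‖)]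
          calc ‖f t - f s‖ ^ 2 / (t - θ) ^ 2
              ≤ (3 / 2 * ‖f t - f s'‖ ^ 2 + 3 * ‖f s - f s'‖ ^ 2) / (t - θ) ^ 2 := by gcongr
            _ = _ := by ring
      _ = ∫⁻ s in arcInterval θ h, (ENNReal.ofReal (3 / 2) * farV f θ (2 * h) +
          ENNReal.ofReal 3 * ((∫⁻ s' in arcInterval θ (2 * h), ENNReal.ofReal (‖f s - f s'‖ ^ 2)) *
            ∫⁻ t in S, ENNReal.ofReal (1 / (t - θ) ^ 2))) := by
          refine lintegral_congr fun s => ?_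
          have e1 : farV f θ (2 * h) = ∫⁻ t in S, ∫⁻ s' in arcInterval θ (2 * h),
              ENNReal.ofReal (‖f t - f s'‖ ^ 2 / (t - θ) ^ 2) := by
            unfold farV
            rw [lintegral_lintegral_swap]
            apply Measurable.aemeasurable
            fun_prop
          have m1 : Measurable fun s' : ℝ => ENNReal.ofReal (‖f s - f s'‖ ^ 2) := by fun_prop
          have m2 : Measurable fun t : ℝ => ENNReal.ofReal (1 / (t - θ) ^ 2) := by fun_prop
          rw [e1, ← lintegral_const_mul' _ _ ENNReal.ofReal_ne_top, ← lintegral_const_mul _ m2,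
            ← lintegral_const_mul' _ _ ENNReal.ofReal_ne_top, ← lintegral_add_right]
          · refine lintegral_congr fun t => ?_
            rw [lintegral_add_right _ (by fun_prop), lintegral_const_mul' _ _ ENNReal.ofReal_ne_top,
              lintegral_const_mul' _ _ ENNReal.ofReal_ne_top,
              lintegral_mul_const' _ _ ENNReal.ofReal_ne_top]
          · fun_prop
      _ = ENNReal.ofReal (2 * π * h) * (ENNReal.ofReal (3 / 2) * farV f θ (2 * h)) +
          ENNReal.ofReal 3 * ((∫⁻ s in arcInterval θ h, ∫⁻ s' in arcInterval θ (2 * h),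
            ENNReal.ofReal (‖f s - f s'‖ ^ 2)) * ∫⁻ t in S, ENNReal.ofReal (1 / (t - θ) ^ 2)) := by
          rw [lintegral_add_left measurable_const, setLIntegral_const, volume_arc,
            lintegral_const_mul' _ _ ENNReal.ofReal_ne_top, lintegral_mul_const, mul_comm]
          apply Measurable.lintegral_prod_right' (f := fun z : ℝ × ℝ =>
            ENNReal.ofReal (‖f z.1 - f z.2‖ ^ 2))
          fun_prop
      _ ≤ ENNReal.ofReal (2 * π * h) * (ENNReal.ofReal (3 / 2) * ENNReal.ofReal (8 * OC)) +
          ENNReal.ofReal 3 * (ENNReal.ofReal (OC * (2 * h) ^ 2) *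
            ENNReal.ofReal (2 / (π * (2 * (2 * h))))) := by
          gcongr
          · exact (lintegral_mono_set (arc_mono θ (by linarith))).trans hO
          · refine (lintegral_mono_set ?_).trans (lint_inv_sq θ (by positivity))
            intro t ht
            exact not_mem_arc ht.2
      _ ≤ _ := by
          rw [← ENNReal.ofReal_mul (by positivity), ← ENNReal.ofReal_mul (by positivity),
            ← ENNReal.ofReal_mul (by positivity), ← ENNReal.ofReal_mul (by positivity),
            ← ENNReal.ofReal_mul (by positivity), ← ENNReal.ofReal_add (by positivity)
            (by positivity)]
          apply ENNReal.ofReal_le_ofReal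
          have : 2 / (π * (2 * (2 * h))) = 1 / (2 * π * h) := by field_simp
          rw [this]
          have e : 3 * (OC * (2 * h) ^ 2 * (1 / (2 * π * h))) = 6 * OC * h / π := by
            field_simp; ring
          rw [e]
          have : 6 * OC * h / π ≤ 4 * π * h * OC := by
            rw [div_le_iff₀ (by positivity)]
            have : 0 ≤ OC * h := by positivity
            nlinarith [mul_nonneg this (by nlinarith : 0 ≤ 4 * (π * π) - 6)]
          nlinarith
  rwa [ENNReal.mul_le_mul_iff_right (by simp; positivity) ENNReal.ofReal_ne_top] at key

lemma far_bound {OC : ℝ} (hOC : 0 ≤ OC) {f : ℝ → ℂ} (hfm : Measurable f) (θ : ℝ)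
    (hO : ∀ h ∈ Ioc (0 : ℝ) 1, ∫⁻ s in arcInterval θ h, ∫⁻ t in arcInterval θ h,
      ENNReal.ofReal (‖f s - f t‖ ^ 2) ≤ ENNReal.ofReal (OC * h ^ 2))
    (n : ℕ) : ∀ h ∈ Ioc (0 : ℝ) 1, 1 / 4 < 2 ^ n * h → farV f θ h ≤ ENNReal.ofReal (8 * OC) := by
  induction n with
  | zero =>
    intro h hh h4
    refine (far_piece hOC f θ hh.1 hh.2 (by linarith) (hO 1 (by simp))).trans ?_
    apply ENNReal.ofReal_le_ofReal; linarith
  | succ n ih =>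
    intro h hh h4
    by_cases hq : 1 / 4 < h
    · refine (far_piece hOC f θ hh.1 hh.2 (by linarith) (hO 1 (by simp))).trans ?_
      apply ENNReal.ofReal_le_ofReal; linarith
    have hh0 := hh.1
    have hsub : arcInterval θ 1 \ arcInterval θ (2 * h) ⊆
        (arcInterval θ (4 * h) \ arcInterval θ (2 * h)) ∪
        (arcInterval θ 1 \ arcInterval θ (2 * (2 * h))) := by
      intro t ht
      by_cases h' : t ∈ arcInterval θ (4 * h)
      · exact Or.inl ⟨h', ht.2⟩
      · right; rw [show 2 * (2 * h) = 4 * h by ring]; exact ⟨ht.1, h'⟩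
    have hV := ih (2 * h) ⟨by linarith, by linarith⟩ (by rw [pow_succ] at h4; linarith)
    calc farV f θ h ≤ ∫⁻ s in arcInterval θ h,
          ((∫⁻ t in arcInterval θ (4 * h) \ arcInterval θ (2 * h),
            ENNReal.ofReal (‖f t - f s‖ ^ 2 / (t - θ) ^ 2)) +
          ∫⁻ t in arcInterval θ 1 \ arcInterval θ (2 * (2 * h)),
            ENNReal.ofReal (‖f t - f s‖ ^ 2 / (t - θ) ^ 2)) := by
          refine lintegral_mono fun s => ?_
          exact (lintegral_mono_set hsub).trans (lintegral_union_le _ _ _)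
      _ = _ := by
          rw [lintegral_add_left]
          apply Measurable.lintegral_prod_right' (f := fun z : ℝ × ℝ =>
            ENNReal.ofReal (‖f z.2 - f z.1‖ ^ 2 / (z.2 - θ) ^ 2))
          fun_prop
      _ ≤ ENNReal.ofReal OC + ENNReal.ofReal (7 * OC) := by
          gcongr
          · exact far_piece hOC f θ hh.1 (by linarith) le_rfl
              (hO _ ⟨by linarith, by linarith⟩)
          · exact far_step hOC hfm θ hh.1 (hO _ ⟨by linarith, by linarith⟩) hV
      _ = _ := by
          rw [← ENNReal.ofReal_add (by positivity) (by positivity)]; congr 1; ring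

lemma far_bound' {OC : ℝ} (hOC : 0 ≤ OC) {f : ℝ → ℂ} (hfm : Measurable f) (θ : ℝ)
    (hO : ∀ h ∈ Ioc (0 : ℝ) 1, ∫⁻ s in arcInterval θ h, ∫⁻ t in arcInterval θ h,
      ENNReal.ofReal (‖f s - f t‖ ^ 2) ≤ ENNReal.ofReal (OC * h ^ 2)) {h : ℝ}
    (hh : h ∈ Ioc (0 : ℝ) 1) : farV f θ h ≤ ENNReal.ofReal (8 * OC) := by
  obtain ⟨n, hn⟩ := pow_unbounded_of_one_lt (1 / 4 / h) (one_lt_two (α := ℝ))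
  refine far_bound hOC hfm θ hO n h hh ?_
  rwa [div_lt_iff₀ hh.1] at hn


lemma far_kernel {p : ℝ} (hp0 : 0 < p) {θ h s t : ℝ} (hh : h ∈ Ioc (0 : ℝ) 1)
    (hs : s ∈ arcInterval θ h) (ht : t ∈ arcInterval θ 1 \ arcInterval θ (2 * h)) (X : ℝ) :
    ∫⁻ δ in Ioo (0 : ℝ) h, ENNReal.ofReal (δ ^ (p - 1)) *
        ENNReal.ofReal (X ^ 2 / ‖ee t - ((1 - δ : ℝ) : ℂ) * ee s‖ ^ 2)
      ≤ ENNReal.ofReal (400 * h ^ p / p) * ENNReal.ofReal (X ^ 2 / (t - θ) ^ 2) := by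
  have hh0 := hh.1
  have hpi := Real.pi_gt_three
  have h1 := not_mem_arc ht.2
  have h2 := mem_arc.1 ht.1
  have h3 := mem_arc.1 hs
  have ht0 : 0 < |t - θ| := lt_of_lt_of_le (by positivity) h1
  have h4 : |t - θ| / 2 ≤ |t - s| := by
    have := abs_sub_le t s θ
    linarith
  have h5 : |t - s| ≤ 3 * π / 2 := by
    have := abs_sub_le t θ s
    rw [abs_sub_comm θ s] at this
    linarith
  have h6 := chord_ge h5
  have := lint_Ioc_rpow (q := p - 1) (a := h) (by linarith) hh0.le
  rw [show p - 1 + 1 = p by ring] at this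
  calc _ ≤ ∫⁻ δ in Ioc (0 : ℝ) h, ENNReal.ofReal (δ ^ (p - 1)) *
        ENNReal.ofReal (400 * (X ^ 2 / (t - θ) ^ 2)) := by
        refine (setLIntegral_mono' measurableSet_Ioo fun δ hδ => ?_).trans
          (lintegral_mono_set Ioo_subset_Ioc_self)
        gcongr
        have := (kernel_lower ⟨hδ.1, hδ.2.trans_le hh.2⟩ s t).2
        have h7 : |t - θ| / 20 ≤ ‖ee t - ((1 - δ : ℝ) : ℂ) * ee s‖ := by linarith
        calc _ ≤ X ^ 2 / (|t - θ| / 20) ^ 2 := by gcongr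
          _ = _ := by rw [div_pow, sq_abs, div_div_eq_mul_div]; ring
    _ = _ := by
        rw [lintegral_mul_const' _ _ ENNReal.ofReal_ne_top, this,
          ← ENNReal.ofReal_mul (by positivity), ← ENNReal.ofReal_mul (by positivity)]
        congr 1; ring

lemma forward {p : ℝ} (hp0 : 0 < p) (hp1 : p < 1) {f : ℝ → ℂ} (hfm : Measurable f)
    (hfper : Function.Periodic f (2 * π)) (hfL2 : l2Circle f < ⊤) {C : ℝ} (hC : 0 ≤ C)
    (hQ : ∀ θ : ℝ, ∀ h ∈ Ioc (0 : ℝ) 1, qpTDouble p f θ h ≤ ENNReal.ofReal (C * h ^ p)) :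
    IsPCarleson p (diskMeasure (dens p f)) := by
  have hf := intervalIntegrable_of_l2 hfm hfL2
  set Kc := 4 * (1 / p + 1 / (2 - p)) with hKc
  have hKc0 : 0 ≤ Kc := by
    have : 0 < 2 - p := by linarith
    positivity
  set OC := C * (2 * π) ^ 2 with hOCd
  have hOC : 0 ≤ OC := by positivity
  refine ⟨Kc * (C * 2) + 400 / p * (8 * OC), fun θ h hh => ?_⟩
  have hh0 := hh.1
  have hV : farV f θ h ≤ ENNReal.ofReal (8 * OC) :=
    far_bound' hOC hfm θ (fun k hk => osc_bound hp0 hp1 hC hfper θ hk (hQ θ k hk)) hh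
  set k := min (2 * h) 1 with hk
  have hk1 : k ∈ Ioc (0 : ℝ) 1 := ⟨lt_min (by linarith) one_pos, min_le_right _ _⟩
  have hhk : h ≤ k := le_min (by linarith) hh.2
  have hcov : arcInterval θ 1 ⊆ arcInterval θ k ∪ (arcInterval θ 1 \ arcInterval θ (2 * h)) := by
    intro t ht
    by_cases h' : t ∈ arcInterval θ (2 * h)
    · left
      rw [mem_arc] at *
      rcases min_choice (2 * h) 1 with e | e <;> rw [hk, e] <;> assumption
    · exact Or.inr ⟨ht, h'⟩
  refine (box_upper hp1 f θ hh).trans ?_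
  calc _ ≤ ∫⁻ s in arcInterval θ h, (ENNReal.ofReal Kc * (∫⁻ t in arcInterval θ k,
        ENNReal.ofReal (‖f s - f t‖ ^ 2 / ‖ee s - ee t‖ ^ (2 - p))) +
        ENNReal.ofReal (400 * h ^ p / p) *
        ∫⁻ t in arcInterval θ 1 \ arcInterval θ (2 * h),
          ENNReal.ofReal (‖f t - f s‖ ^ 2 / (t - θ) ^ 2)) := by
        refine setLIntegral_mono' (measurableSet_arc _ _) fun s hs => ?_
        calc _ ≤ ∫⁻ δ in Ioo 0 h, ∫⁻ t in arcInterval θ 1, ENNReal.ofReal (δ ^ (p - 1)) *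
              ENNReal.ofReal (‖f t - f s‖ ^ 2 / ‖ee t - ((1 - δ : ℝ) : ℂ) * ee s‖ ^ 2) := by
              refine setLIntegral_mono' measurableSet_Ioo fun δ hδ => ?_
              rw [lintegral_const_mul' _ _ ENNReal.ofReal_ne_top]
              gcongr
              have hper : Function.Periodic (fun t => ENNReal.ofReal (‖f t - f s‖ ^ 2 /
                  ‖ee t - ((1 - δ : ℝ) : ℂ) * ee s‖ ^ 2)) (2 * π) := by
                intro t
                simp only
                rw [hfper t, ee_periodic t]
              rw [lint_arc_one hper θ 0, zero_add]
              refine gradSq_bound hfm hf ?_ _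
              rw [norm_real_mul_ee (by linarith [hδ.2, hh.2])]
              linarith [hδ.1]
          _ = ∫⁻ t in arcInterval θ 1, ∫⁻ δ in Ioo 0 h, ENNReal.ofReal (δ ^ (p - 1)) *
              ENNReal.ofReal (‖f t - f s‖ ^ 2 / ‖ee t - ((1 - δ : ℝ) : ℂ) * ee s‖ ^ 2) := by
              rw [lintegral_lintegral_swap]
              apply Measurable.aemeasurable
              have := continuous_ee.measurable
              simp only [Function.uncurry_def]
              fun_prop
          _ ≤ _ := (lintegral_mono_set hcov).trans (lintegral_union_le _ _ _)
          _ ≤ _ := by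
              rw [← lintegral_const_mul' _ _ ENNReal.ofReal_ne_top,
                ← lintegral_const_mul' _ _ ENNReal.ofReal_ne_top]
              gcongr ?_ + ?_
              · refine lintegral_mono fun t => ?_
                refine (lintegral_mono_set (Ioo_subset_Ioo_right hh.2)).trans ?_
                rw [norm_sub_rev (f s), norm_sub_rev (ee s)]
                refine near_kernel hp0 hp1 s t _ fun h0 => ?_
                rw [eq_of_ee_eq hfper h0, sub_self, norm_zero]
              · refine setLIntegral_mono' ((measurableSet_arc _ _).diff (measurableSet_arc _ _))
                  fun t ht => far_kernel hp0 hh hs ht _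
    _ ≤ ENNReal.ofReal Kc * qpTDouble p f θ k + ENNReal.ofReal (400 * h ^ p / p) * farV f θ h := by
        rw [lintegral_add_right, lintegral_const_mul' _ _ ENNReal.ofReal_ne_top,
          lintegral_const_mul' _ _ ENNReal.ofReal_ne_top]
        · gcongr
          · exact lintegral_mono_set (arc_mono θ hhk)
          · exact le_rfl
        · apply Measurable.const_mul
          apply Measurable.lintegral_prod_right' (f := fun z : ℝ × ℝ =>
            ENNReal.ofReal (‖f z.2 - f z.1‖ ^ 2 / (z.2 - θ) ^ 2))
          fun_prop
    _ ≤ ENNReal.ofReal Kc * ENNReal.ofReal (C * k ^ p) +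
          ENNReal.ofReal (400 * h ^ p / p) * ENNReal.ofReal (8 * OC) := by
        gcongr
        exact hQ θ k hk1
    _ ≤ _ := by
        have hk0 := hk1.1
        rw [← ENNReal.ofReal_mul (by positivity), ← ENNReal.ofReal_mul (by positivity),
          ← ENNReal.ofReal_add (by positivity) (by positivity)]
        apply ENNReal.ofReal_le_ofReal
        have : k ^ p ≤ 2 * h ^ p := by
          calc k ^ p ≤ (2 * h) ^ p := Real.rpow_le_rpow hk0.le (min_le_left _ _) hp0.le
            _ = 2 ^ p * h ^ p := Real.mul_rpow (by norm_num) hh0.le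
            _ ≤ 2 * h ^ p := by
                gcongr
                calc (2 : ℝ) ^ p ≤ 2 ^ (1 : ℝ) :=
                      Real.rpow_le_rpow_of_exponent_le (by norm_num) hp1.le
                  _ = 2 := by norm_num
        calc _ ≤ Kc * (C * (2 * h ^ p)) + 400 * h ^ p / p * (8 * OC) := by gcongr
          _ = _ := by ring


/-- A sequence of radii tending to one. -/
def rr (n : ℕ) : ℝ := 1 - 1 / ((n : ℝ) + 2)

lemma rr_mem (n : ℕ) : rr n ∈ Ioo (0 : ℝ) 1 := by
  unfold rr
  have h : (0 : ℝ) < (n : ℝ) + 2 := by positivity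
  refine ⟨?_, ?_⟩
  · rw [sub_pos, div_lt_one h]; linarith [(Nat.cast_nonneg n : (0 : ℝ) ≤ n)]
  · have : 0 < 1 / ((n : ℝ) + 2) := by positivity
    linarith

lemma rr_tendsto : Tendsto rr atTop (𝓝 1) := by
  have h : Tendsto (fun n : ℕ => 1 / ((n : ℝ) + 2)) atTop (𝓝 0) := by
    have := tendsto_one_div_add_atTop_nhds_zero_nat (𝕜 := ℝ)
    have h2 := this.comp (tendsto_add_atTop_nat 1)
    refine h2.congr fun n => ?_
    simp only [Function.comp]
    push_cast; congr 1; ring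
  have := (tendsto_const_nhds (x := (1 : ℝ))).sub h
  rwa [sub_zero] at this

lemma rr_ball (n : ℕ) (s : ℝ) : ‖((rr n : ℝ) : ℂ) * ee s‖ < 1 := by
  rw [norm_real_mul_ee (rr_mem n).1.le]; exact (rr_mem n).2

lemma pk_symm (r s t : ℝ) : ‖ee t - (r : ℂ) * ee s‖ = ‖ee s - (r : ℂ) * ee t‖ := by
  have e : ee t - (r : ℂ) * ee s = -(ee t * ee s) * (starRingEnd ℂ) ((r : ℂ) * ee t - ee s) := by
    have h : ∀ x : ℝ, ee x * (starRingEnd ℂ) (ee x) = 1 := fun x => by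
      rw [Complex.mul_conj, Complex.normSq_eq_norm_sq, norm_ee]; simp
    have h1 := h s
    have h2 := h t
    simp only [map_sub, map_mul, Complex.conj_ofReal]
    linear_combination (-ee t) * h1 + (r : ℂ) * ee s * h2
  rw [e, norm_mul, norm_neg, norm_mul, norm_ee, norm_ee, RCLike.norm_conj, norm_sub_rev]
  ring

lemma pk_integrable {g : ℝ → ℂ} (hg : IntervalIntegrable g volume 0 (2 * π)) {z : ℂ}
    (hz : ‖z‖ < 1) :
    IntervalIntegrable (fun t => ((1 - ‖z‖ ^ 2) / ‖ee t - z‖ ^ 2) • g t) volume 0 (2 * π) :=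
  hg.continuousOn_smul (cont_pk hz).continuousOn

lemma poissonExt_sub {f g : ℝ → ℂ} (hf : IntervalIntegrable f volume 0 (2 * π))
    (hg : IntervalIntegrable g volume 0 (2 * π)) {z : ℂ} (hz : ‖z‖ < 1) :
    poissonExt (f - g) z = poissonExt f z - poissonExt g z := by
  have h1 := pk_integrable hf hz
  have h2 := pk_integrable hg hz
  unfold poissonExt
  rw [← smul_sub]
  congr 1
  change ∫ t in (0 : ℝ)..(2 * π), ((1 - ‖z‖ ^ 2) / ‖ee t - z‖ ^ 2) • (f t - g t) = _
  simp only [smul_sub]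
  exact intervalIntegral.integral_sub h1 h2

lemma poissonExt_enorm_le (g : ℝ → ℂ) {z : ℂ} (hz : ‖z‖ < 1) :
    ‖poissonExt g z‖ₑ ≤ ENNReal.ofReal (1 / (2 * π)) * ∫⁻ t in Ioc (0 : ℝ) (2 * π),
      ENNReal.ofReal ((1 - ‖z‖ ^ 2) / ‖ee t - z‖ ^ 2) * ‖g t‖ₑ := by
  have hpos := one_sub_sq_pos hz
  unfold poissonExt
  rw [enorm_smul, Real.enorm_eq_ofReal (by positivity)]
  gcongr
  rw [intervalIntegral.integral_of_le (by positivity)]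
  refine (enorm_integral_le_lintegral_enorm _).trans (lintegral_mono fun t => ?_)
  simp only
  rw [enorm_smul, Real.enorm_eq_ofReal (by positivity)]
  exact le_rfl

lemma cont_circle {g : ℝ → ℂ} (hg : IntervalIntegrable g volume 0 (2 * π)) {r : ℝ}
    (hr : r ∈ Ioo (0 : ℝ) 1) : Continuous fun s : ℝ => poissonExt g ((r : ℂ) * ee s) := by
  refine (contDiffOn_poissonExt hg).continuousOn.comp_continuous
    (continuous_const.mul continuous_ee) fun s => ?_
  rw [mem_ball_zero_iff, norm_real_mul_ee hr.1.le]; exact hr.2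

lemma poisson_contr {g : ℝ → ℂ} (hgm : Measurable g) {r : ℝ} (hr : r ∈ Ioo (0 : ℝ) 1) :
    ∫⁻ s in Ioc (0 : ℝ) (2 * π), ‖poissonExt g ((r : ℂ) * ee s)‖ₑ ≤
      ∫⁻ t in Ioc (0 : ℝ) (2 * π), ‖g t‖ₑ := by
  have hb : ∀ s, ‖(r : ℂ) * ee s‖ < 1 := fun s => by rw [norm_real_mul_ee hr.1.le]; exact hr.2
  have hm := continuous_ee.measurable
  calc _ ≤ ∫⁻ s in Ioc (0 : ℝ) (2 * π), ENNReal.ofReal (1 / (2 * π)) *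
        ∫⁻ t in Ioc (0 : ℝ) (2 * π),
        ENNReal.ofReal ((1 - ‖(r : ℂ) * ee s‖ ^ 2) / ‖ee t - (r : ℂ) * ee s‖ ^ 2) * ‖g t‖ₑ :=
        lintegral_mono fun s => poissonExt_enorm_le g (hb s)
    _ = ENNReal.ofReal (1 / (2 * π)) * ∫⁻ t in Ioc (0 : ℝ) (2 * π), ∫⁻ s in Ioc (0 : ℝ) (2 * π),
        ENNReal.ofReal ((1 - ‖(r : ℂ) * ee t‖ ^ 2) / ‖ee s - (r : ℂ) * ee t‖ ^ 2) * ‖g t‖ₑ := by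
        rw [lintegral_const_mul' _ _ ENNReal.ofReal_ne_top, lintegral_lintegral_swap]
        · congr 1
          refine lintegral_congr fun t => lintegral_congr fun s => ?_
          rw [pk_symm, norm_real_mul_ee hr.1.le, norm_real_mul_ee hr.1.le]
        · apply Measurable.aemeasurable
          simp only [Function.uncurry_def]
          fun_prop
    _ = ENNReal.ofReal (1 / (2 * π)) * ∫⁻ t in Ioc (0 : ℝ) (2 * π),
          ENNReal.ofReal (2 * π) * ‖g t‖ₑ := by
        congr 1
        refine lintegral_congr fun t => ?_
        rw [lintegral_mul_const' _ _ enorm_ne_top, lintegral_poisson_kernel (hb t)]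
    _ = _ := by
        rw [lintegral_const_mul' _ _ ENNReal.ofReal_ne_top, ← mul_assoc,
          ← ENNReal.ofReal_mul (by positivity)]
        have : 1 / (2 * π) * (2 * π) = 1 := by field_simp
        rw [this]; simp

lemma poisson_bdd {g : ℝ → ℂ} {M : ℝ≥0∞} (hM : M ≠ ⊤) (hg : ∀ t, ‖g t‖ₑ ≤ M) {z : ℂ}
    (hz : ‖z‖ < 1) : ‖poissonExt g z‖ₑ ≤ M := by
  refine (poissonExt_enorm_le g hz).trans ?_
  calc _ ≤ ENNReal.ofReal (1 / (2 * π)) * ∫⁻ t in Ioc (0 : ℝ) (2 * π),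
        ENNReal.ofReal ((1 - ‖z‖ ^ 2) / ‖ee t - z‖ ^ 2) * M := by
        gcongr with t; exact hg t
    _ = _ := by
        rw [lintegral_mul_const' _ _ hM, lintegral_poisson_kernel hz, ← mul_assoc,
          ← ENNReal.ofReal_mul (by positivity)]
        have : 1 / (2 * π) * (2 * π) = 1 := by field_simp
        rw [this]; simp

lemma poisson_pointwise {g : ℝ → ℂ} (hg : Continuous g) {s : ℝ} (hs : s ∈ Ioo 0 (2 * π)) :
    Tendsto (fun n => poissonExt g (((rr n : ℝ) : ℂ) * ee s)) atTop (𝓝 (g s)) := by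
  have key := tendsto_setIntegral_peak_smul_of_integrableOn_of_tendsto (μ := volume)
    (s := Ioc (0 : ℝ) (2 * π)) (t := Ioc (0 : ℝ) (2 * π)) (x₀ := s) (l := atTop)
    (φ := fun (n : ℕ) t => 1 / (2 * π) *
      ((1 - ‖((rr n : ℝ) : ℂ) * ee s‖ ^ 2) / ‖ee t - ((rr n : ℝ) : ℂ) * ee s‖ ^ 2))
    (g := g) (a := g s) measurableSet_Ioc measurableSet_Ioc subset_rfl self_mem_nhdsWithin
    measure_Ioc_lt_top.ne ?_ ?_ ?_ ?_ ?_ ?_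
  · refine key.congr fun n => ?_
    unfold poissonExt
    rw [intervalIntegral.integral_of_le (by positivity), ← integral_smul]
    refine integral_congr_ae (Eventually.of_forall fun t => ?_)
    simp only [smul_smul]
    rfl
  · refine Eventually.of_forall fun n t _ => ?_
    have := one_sub_sq_pos (rr_ball n s)
    positivity
  · intro u hu hsu
    obtain ⟨m, hm0, hm⟩ : ∃ m > 0, ∀ t ∈ Ioc 0 (2 * π) \ u, m ≤ ‖ee t - ee s‖ := by
      have hK : IsCompact (Icc 0 (2 * π) \ u) := isCompact_Icc.diff hu
      by_cases hne : (Icc 0 (2 * π) \ u).Nonempty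
      · obtain ⟨t0, ht0, hmin⟩ := hK.exists_isMinOn hne
          (f := fun t => ‖ee t - ee s‖) (by have := continuous_ee; fun_prop)
        refine ⟨‖ee t0 - ee s‖, ?_, fun t ht => hmin ⟨Ioc_subset_Icc_self ht.1, ht.2⟩⟩
        rw [gt_iff_lt, chord_eq]
        have h1 : Real.sin ((t0 - s) / 2) ≠ 0 := by
          intro h0
          rw [Real.sin_eq_zero_iff_of_lt_of_lt] at h0
          · have : t0 = s := by linarith
            exact ht0.2 (this ▸ hsu)
          · linarith [ht0.1.1, hs.2]
          · linarith [ht0.1.2, hs.1]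
        positivity
      · refine ⟨1, one_pos, fun t ht => ?_⟩
        exact absurd ⟨t, Ioc_subset_Icc_self ht.1, ht.2⟩ hne
    rw [Metric.tendstoUniformlyOn_iff]
    intro ε hε
    have hlim : Tendsto (fun n => 1 / (2 * π) * ((1 - rr n ^ 2) / (m / 2) ^ 2)) atTop (𝓝 0) := by
      have := (((tendsto_const_nhds (x := (1 : ℝ))).sub (rr_tendsto.pow 2)).div_const
        ((m / 2) ^ 2)).const_mul (1 / (2 * π))
      simpa using this
    filter_upwards [hlim.eventually (gt_mem_nhds hε)] with n hn t ht
    have hpos := one_sub_sq_pos (rr_ball n s)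
    rw [Pi.zero_apply, dist_zero_left, Real.norm_of_nonneg (by positivity)]
    refine lt_of_le_of_lt ?_ hn
    rw [norm_real_mul_ee (rr_mem n).1.le] at hpos ⊢
    have h1 := (kernel_lower (δ := 1 - rr n) ⟨by linarith [(rr_mem n).2], by linarith [(rr_mem n).1]⟩
      s t).2
    rw [sub_sub_cancel] at h1
    have := hm t ht
    gcongr
    linarith
  · have : ∀ n : ℕ, ∫ t in Ioc (0 : ℝ) (2 * π), 1 / (2 * π) *
      ((1 - ‖((rr n : ℝ) : ℂ) * ee s‖ ^ 2) / ‖ee t - ((rr n : ℝ) : ℂ) * ee s‖ ^ 2) = 1 := by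
      intro n
      rw [integral_const_mul, ← intervalIntegral.integral_of_le (by positivity),
        integral_poisson_kernel (rr_ball n s)]
      field_simp
    simp only [this]
    exact tendsto_const_nhds
  · refine Eventually.of_forall fun n => ?_
    exact ((cont_pk (rr_ball n s)).const_mul _).aestronglyMeasurable
  · exact hg.continuousOn.integrableOn_compact isCompact_Icc |>.mono_set Ioc_subset_Icc_self
  · exact hg.continuousAt.tendsto.mono_left nhdsWithin_le_nhds

lemma poisson_L1_cont (g : BoundedContinuousFunction ℝ ℂ) :
    Tendsto (fun n => ∫⁻ s in Ioc (0 : ℝ) (2 * π),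
      ‖poissonExt g (((rr n : ℝ) : ℂ) * ee s) - g s‖ₑ) atTop (𝓝 0) := by
  have hgi : IntervalIntegrable g volume 0 (2 * π) := g.continuous.intervalIntegrable _ _
  have hM : ∀ t, ‖g t‖ₑ ≤ ‖g‖ₑ := fun t => by
    rw [enorm_le_iff_norm_le]; exact g.norm_coe_le_norm t
  have := tendsto_lintegral_of_dominated_convergence' (μ := volume.restrict (Ioc (0 : ℝ) (2 * π)))
    (F := fun n s => ‖poissonExt g (((rr n : ℝ) : ℂ) * ee s) - g s‖ₑ) (f := fun _ => 0)
    (fun _ => ‖g‖ₑ + ‖g‖ₑ) ?_ ?_ ?_ ?_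
  · simpa using this
  · intro n
    exact ((cont_circle hgi (rr_mem n)).sub g.continuous).measurable.enorm.aemeasurable
  · intro n
    refine Eventually.of_forall fun s => ?_
    refine (enorm_sub_le).trans (add_le_add (poisson_bdd enorm_ne_top hM (rr_ball n s)) (hM s))
  · rw [setLIntegral_const]
    exact ENNReal.mul_ne_top (ENNReal.add_ne_top.2 ⟨enorm_ne_top, enorm_ne_top⟩)
      measure_Ioc_lt_top.ne
  · have : ∀ᵐ s ∂(volume.restrict (Ioc (0 : ℝ) (2 * π))), s ∈ Ioo 0 (2 * π) := by
      rw [← restrict_Ioo_eq_restrict_Ioc]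
      exact ae_restrict_mem measurableSet_Ioo
    filter_upwards [this] with s hs
    have h := poisson_pointwise g.continuous hs
    have h2 := (h.sub_const (g s)).enorm
    simpa using h2



lemma poisson_L1 {f : ℝ → ℂ} (hfm : Measurable f) (hf : IntervalIntegrable f volume 0 (2 * π)) :
    Tendsto (fun n => ∫⁻ s in Ioc (0 : ℝ) (2 * π),
      ‖poissonExt f (((rr n : ℝ) : ℂ) * ee s) - f s‖ₑ) atTop (𝓝 0) := by
  rw [ENNReal.tendsto_nhds_zero]
  intro ε hε
  have hε3 : ε / 3 ≠ 0 := by simp [hε.ne']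
  have hfi : Integrable f (volume.restrict (Ioc 0 (2 * π))) :=
    (intervalIntegrable_iff_integrableOn_Ioc_of_le (by positivity)).1 hf
  obtain ⟨g, hg, -⟩ := hfi.exists_boundedContinuous_lintegral_sub_le hε3
  have hgi : IntervalIntegrable g volume 0 (2 * π) := g.continuous.intervalIntegrable _ _
  have hgm : Measurable g := g.continuous.measurable
  filter_upwards [(ENNReal.tendsto_nhds_zero.1 (poisson_L1_cont g)) (ε / 3) (by positivity)] with n hn
  calc _ ≤ ∫⁻ s in Ioc (0 : ℝ) (2 * π), (‖poissonExt (f - g) (((rr n : ℝ) : ℂ) * ee s)‖ₑ +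
        ‖poissonExt g (((rr n : ℝ) : ℂ) * ee s) - g s‖ₑ + ‖f s - g s‖ₑ) := by
        refine lintegral_mono fun s => ?_
        simp only
        rw [poissonExt_sub hf hgi (rr_ball n s)]
        have e : poissonExt f (((rr n : ℝ) : ℂ) * ee s) - f s =
          (poissonExt f (((rr n : ℝ) : ℂ) * ee s) - poissonExt g (((rr n : ℝ) : ℂ) * ee s)) +
          (poissonExt g (((rr n : ℝ) : ℂ) * ee s) - g s) - (f s - g s) := by ring
        rw [e]
        refine enorm_sub_le.trans ?_
        gcongr
        exact enorm_add_le _ _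
    _ = (∫⁻ s in Ioc (0 : ℝ) (2 * π), ‖poissonExt (f - g) (((rr n : ℝ) : ℂ) * ee s)‖ₑ) +
        (∫⁻ s in Ioc (0 : ℝ) (2 * π), ‖poissonExt g (((rr n : ℝ) : ℂ) * ee s) - g s‖ₑ) +
        ∫⁻ s in Ioc (0 : ℝ) (2 * π), ‖f s - g s‖ₑ := by
        have hm1 : Measurable fun s => ‖f s - g s‖ₑ := (hfm.sub hgm).enorm
        rw [lintegral_add_right _ hm1, lintegral_add_right]
        exact ((cont_circle hgi (rr_mem n)).sub g.continuous).measurable.enorm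
    _ ≤ ε / 3 + ε / 3 + ε / 3 := by
        gcongr
        refine (poisson_contr (hfm.sub hgm) (rr_mem n)).trans hg
    _ = ε := ENNReal.add_thirds ε

lemma radial_limit {f : ℝ → ℂ} (hfm : Measurable f) (hfper : Function.Periodic f (2 * π))
    (hf : IntervalIntegrable f volume 0 (2 * π)) :
    ∃ r : ℕ → ℝ, (∀ n, r n ∈ Ioo (0 : ℝ) 1) ∧ Tendsto r atTop (𝓝 1) ∧
      ∀ᵐ s : ℝ, Tendsto (fun n => poissonExt f ((r n : ℂ) * ee s)) atTop (𝓝 (f s)) := by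
  have h1 : TendstoInMeasure (volume.restrict (Ioc (0 : ℝ) (2 * π)))
      (fun n s => poissonExt f (((rr n : ℝ) : ℂ) * ee s)) atTop f := by
    refine tendstoInMeasure_of_tendsto_eLpNorm (p := 1) one_ne_zero
      (fun n => (cont_circle hf (rr_mem n)).aestronglyMeasurable) hfm.aestronglyMeasurable ?_
    simp only [eLpNorm_one_eq_lintegral_enorm]
    exact poisson_L1 hfm hf
  obtain ⟨ns, hns, hae⟩ := h1.exists_seq_tendsto_ae
  refine ⟨fun n => rr (ns n), fun n => rr_mem _, rr_tendsto.comp hns.tendsto_atTop, ?_⟩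
  have h2 : (0 : ℝ) < 2 * π := by positivity
  rw [ae_iff] at hae ⊢
  refine (isAddFundamentalDomain_Ioc h2 0).measure_zero_of_invariant _ ?_ ?_
  · rintro ⟨_, ⟨k, rfl⟩⟩
    ext x
    rw [mem_vadd_set_iff_neg_vadd_mem]
    have e : ∀ y : ℝ, ((-(k • (2 * π)) + y : ℝ) ∈ {a | ¬Tendsto (fun n =>
        poissonExt f (((rr (ns n) : ℝ) : ℂ) * ee a)) atTop (𝓝 (f a))} ↔ y ∈ {a | ¬Tendsto (fun n =>
        poissonExt f (((rr (ns n) : ℝ) : ℂ) * ee a)) atTop (𝓝 (f a))}) := by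
      intro y
      have e1 : f (-(k • (2 * π)) + y) = f y := by
        rw [add_comm, ← sub_eq_add_neg]; exact hfper.sub_zsmul_eq k
      have e2 : ee (-(k • (2 * π)) + y) = ee y := by
        rw [add_comm, ← sub_eq_add_neg]
        have : Function.Periodic ee (2 * π) := ee_periodic
        exact this.sub_zsmul_eq k
      simp only [mem_ofPred_eq, e1, e2]
    exact e x
  · rw [zero_add]
    rwa [Measure.restrict_apply₀' measurableSet_Ioc.nullMeasurableSet] at hae


lemma path_bound {f : ℝ → ℂ} (hf : IntervalIntegrable f volume 0 (2 * π)) {γ γ' : ℝ → ℂ}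
    (hγc : ContDiff ℝ 1 γ) (hγ : ∀ x, HasDerivAt γ (γ' x) x) {a b : ℝ} (hab : a ≤ b)
    (h1 : ∀ x ∈ Icc a b, ‖γ' x‖ ≤ 1) (hb : ∀ x ∈ Icc a b, ‖γ x‖ < 1) :
    ‖poissonExt f (γ b) - poissonExt f (γ a)‖ₑ ≤
      ∫⁻ x in Icc a b, ENNReal.ofReal √(gradSq (poissonExt f) (γ x)) := by
  have hc : ContDiffOn ℝ 1 (fun x => poissonExt f (γ x)) (Icc a b) :=
    (contDiffOn_poissonExt hf).comp hγc.contDiffOn fun x hx => by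
      rw [mem_ball_zero_iff]; exact hb x hx
  refine (enorm_sub_le_lintegral_deriv_of_contDiffOn_Icc hc hab).trans ?_
  refine setLIntegral_mono' measurableSet_Icc fun x hx => ?_
  have hd : DifferentiableAt ℝ (poissonExt f) (γ x) :=
    ((contDiffOn_poissonExt hf).differentiableOn one_ne_zero).differentiableAt
      (isOpen_ball.mem_nhds (by rw [mem_ball_zero_iff]; exact hb x hx))
  have hder : deriv (fun x => poissonExt f (γ x)) x = fderiv ℝ (poissonExt f) (γ x) (γ' x) :=
    (hd.hasFDerivAt.comp_hasDerivAt x (hγ x)).deriv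
  rw [hder, ← ofReal_norm]
  apply ENNReal.ofReal_le_ofReal
  refine (norm_fderiv_poissonExt_le hf (hb x hx) _).trans ?_
  exact mul_le_of_le_one_right (Real.sqrt_nonneg _) (h1 x hx)

/-- The squared gradient in polar coordinates. -/
def GG (f : ℝ → ℂ) (τ φ : ℝ) : ℝ := gradSq (poissonExt f) (((1 - τ : ℝ) : ℂ) * ee φ)

lemma hasDerivAt_ee (x : ℝ) : HasDerivAt ee (I * ee x) x := by
  have h : HasDerivAt (fun t : ℝ => Complex.exp (I * (t : ℂ))) (Complex.exp (I * x) * (I * 1)) x :=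
    ((Complex.ofRealCLM.hasDerivAt (x := x)).const_mul I).cexp
  rw [mul_one, mul_comm] at h
  exact h

lemma contDiff_ee : ContDiff ℝ 1 ee := by
  have : ContDiff ℝ 1 (fun t : ℝ => Complex.exp (I * (t : ℂ))) :=
    (contDiff_const.mul Complex.ofRealCLM.contDiff).cexp
  exact this

lemma arc_path {f : ℝ → ℂ} (hf : IntervalIntegrable f volume 0 (2 * π)) {δ : ℝ}
    (hδ : δ ∈ Ioo (0 : ℝ) 1) (s u : ℝ) :
    ‖poissonExt f (((1 - δ : ℝ) : ℂ) * ee s) - poissonExt f (((1 - δ : ℝ) : ℂ) * ee u)‖ₑ ≤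
      ∫⁻ φ in uIcc s u, ENNReal.ofReal √(GG f δ φ) := by
  have h0 : (0 : ℝ) ≤ 1 - δ := by linarith [hδ.2]
  have key : ∀ a b : ℝ, a ≤ b →
    ‖poissonExt f (((1 - δ : ℝ) : ℂ) * ee b) - poissonExt f (((1 - δ : ℝ) : ℂ) * ee a)‖ₑ ≤
      ∫⁻ φ in Icc a b, ENNReal.ofReal √(GG f δ φ) := fun a b hab => by
    refine path_bound hf (γ := fun x => ((1 - δ : ℝ) : ℂ) * ee x)
      (γ' := fun x => ((1 - δ : ℝ) : ℂ) * (I * ee x)) (contDiff_const.mul contDiff_ee)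
      (fun x => (hasDerivAt_ee x).const_mul _) hab (fun x _ => ?_) (fun x _ => ?_)
    · rw [norm_mul, norm_mul, norm_I, norm_ee, Complex.norm_of_nonneg h0]; linarith [hδ.1]
    · rw [norm_real_mul_ee h0]; linarith [hδ.1]
  rcases le_total s u with h | h
  · rw [uIcc_of_le h, enorm_sub_rev]; exact key s u h
  · rw [uIcc_of_ge h]; exact key u s h

lemma radial_path {f : ℝ → ℂ} (hf : IntervalIntegrable f volume 0 (2 * π)) {δ : ℝ}
    (hδ : δ ∈ Ioo (0 : ℝ) 1) {s : ℝ} {r : ℕ → ℝ} (hr : ∀ n, r n ∈ Ioo (0 : ℝ) 1)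
    (hr1 : Tendsto r atTop (𝓝 1))
    (hs : Tendsto (fun n => poissonExt f ((r n : ℂ) * ee s)) atTop (𝓝 (f s))) :
    ‖poissonExt f (((1 - δ : ℝ) : ℂ) * ee s) - f s‖ₑ ≤
      ∫⁻ τ in Ioc 0 δ, ENNReal.ofReal √(GG f τ s) := by
  have hlim := (hs.const_sub (poissonExt f (((1 - δ : ℝ) : ℂ) * ee s))).enorm
  refine le_of_tendsto hlim ?_
  filter_upwards [hr1.eventually (lt_mem_nhds (show 1 - δ < 1 by linarith [hδ.1]))] with n hn
  have h := path_bound hf (γ := fun x => ((1 - x : ℝ) : ℂ) * ee s)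
    (γ' := fun x => (-1 : ℂ) * ee s) (a := 1 - r n) (b := δ) ?_ ?_ (by linarith) ?_ ?_
  · simp only [sub_sub_cancel] at h
    refine h.trans (lintegral_mono_set fun x hx => ⟨?_, hx.2⟩)
    linarith [hx.1, (hr n).2]
  · refine ContDiff.mul ?_ contDiff_const
    exact Complex.ofRealCLM.contDiff.comp (contDiff_const.sub contDiff_id)
  · intro x
    have h1 : HasDerivAt (fun x : ℝ => 1 - x) (-1) x := (hasDerivAt_id x).const_sub 1
    have h2 := (h1.ofReal_comp).mul_const (ee s)
    simpa using h2
  · intro x _; simp [norm_ee]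
  · intro x hx
    rw [norm_real_mul_ee (by linarith [hx.2, hδ.2])]
    linarith [hx.1, (hr n).2]

/-- Radial integral of the gradient. -/
def Aint (f : ℝ → ℂ) (s y : ℝ) : ℝ≥0∞ := ∫⁻ τ in Ioc 0 y, ENNReal.ofReal √(GG f τ s)

lemma path_ineq {f : ℝ → ℂ} (hfm : Measurable f) (hfper : Function.Periodic f (2 * π))
    (hf : IntervalIntegrable f volume 0 (2 * π)) :
    ∀ᵐ s : ℝ, ∀ᵐ u : ℝ, ∀ δ ∈ Ioo (0 : ℝ) 1, ‖f s - f u‖ₑ ≤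
      Aint f s δ + Aint f u δ + ∫⁻ φ in uIcc s u, ENNReal.ofReal √(GG f δ φ) := by
  obtain ⟨r, hr, hr1, hae⟩ := radial_limit hfm hfper hf
  filter_upwards [hae] with s hs
  filter_upwards [hae] with u hu δ hδ
  have h1 := radial_path hf hδ hr hr1 hs
  have h2 := radial_path hf hδ hr hr1 hu
  have h3 := arc_path hf hδ s u
  set x := poissonExt f (((1 - δ : ℝ) : ℂ) * ee s)
  set y := poissonExt f (((1 - δ : ℝ) : ℂ) * ee u)
  have e : f s - f u = (y - f u) + (x - y) - (x - f s) := by ring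
  rw [e]
  calc _ ≤ ‖y - f u‖ₑ + ‖x - y‖ₑ + ‖x - f s‖ₑ :=
        enorm_sub_le.trans (by gcongr; exact enorm_add_le _ _)
    _ ≤ Aint f u δ + (∫⁻ φ in uIcc s u, ENNReal.ofReal √(GG f δ φ)) + Aint f s δ := by
        gcongr <;> assumption
    _ = _ := by ring


lemma measurable_GG (f : ℝ → ℂ) : Measurable fun q : ℝ × ℝ => GG f q.1 q.2 := by
  unfold GG
  have h1 := measurable_gradSq (poissonExt f)
  have h2 := continuous_ee.measurable
  fun_prop

lemma GG_nonneg (f : ℝ → ℂ) (τ φ : ℝ) : 0 ≤ GG f τ φ := gradSq_nonneg _ _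

lemma sq_ofReal_sqrt {x : ℝ} (hx : 0 ≤ x) : (ENNReal.ofReal √x) ^ 2 = ENNReal.ofReal x := by
  rw [← ENNReal.ofReal_pow (Real.sqrt_nonneg _), Real.sq_sqrt hx]

lemma measurable_Aint (f : ℝ → ℂ) : Measurable fun q : ℝ × ℝ => Aint f q.1 q.2 := by
  have e : (fun q : ℝ × ℝ => Aint f q.1 q.2) = fun q : ℝ × ℝ =>
      ∫⁻ τ, {w : (ℝ × ℝ) × ℝ | 0 < w.2 ∧ w.2 ≤ w.1.2}.indicator
        (fun w => ENNReal.ofReal √(GG f w.2 w.1.1)) (q, τ) := by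
    ext q
    unfold Aint
    rw [← lintegral_indicator measurableSet_Ioc]
    rfl
  rw [e]
  apply Measurable.lintegral_prod_right'
  refine Measurable.indicator ?_ ?_
  · have h0 : Measurable fun w : (ℝ × ℝ) × ℝ => (w.2, w.1.1) := by fun_prop
    have h1 := (measurable_GG f).comp h0
    have h2 : Measurable fun w : (ℝ × ℝ) × ℝ => GG f w.2 w.1.1 := h1
    exact h2.sqrt.ennreal_ofReal
  · have h1 : MeasurableSet {w : (ℝ × ℝ) × ℝ | 0 < w.2} :=
      measurableSet_lt measurable_const measurable_snd
    have h2 : MeasurableSet {w : (ℝ × ℝ) × ℝ | w.2 ≤ w.1.2} :=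
      measurableSet_le measurable_snd (by fun_prop)
    exact h1.inter h2

lemma lint_abs (ψ : ℝ → ℝ≥0∞) : ∫⁻ v : ℝ, ψ |v| = 2 * ∫⁻ y in Ioi 0, ψ y := by
  rw [← lintegral_add_compl _ (measurableSet_Ioi (a := (0 : ℝ))), two_mul]
  congr 1
  · refine setLIntegral_congr_fun measurableSet_Ioi fun x hx => ?_
    simp only [abs_of_pos (show (0 : ℝ) < x from hx)]
  · rw [compl_Ioi, setLIntegral_congr Iio_ae_eq_Iic.symm]
    rw [← (Measure.measurePreserving_neg (volume : Measure ℝ)).setLIntegral_comp_preimage_emb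
      (MeasurableEquiv.neg ℝ).measurableEmbedding _ (Ioi 0)]
    have : (Neg.neg ⁻¹' Ioi (0 : ℝ)) = Iio 0 := by ext x; simp
    rw [this]
    refine setLIntegral_congr_fun measurableSet_Iio fun x hx => ?_
    simp only [abs_of_neg (show x < (0 : ℝ) from hx)]

lemma polar1 {κ : ℝ} (hκ : 0 < κ) {ψ : ℝ → ℝ≥0∞} (hψ : Measurable ψ) (s : ℝ) :
    ∫⁻ u : ℝ, ψ (|s - u| / κ) = ENNReal.ofReal (2 * κ) * ∫⁻ y in Ioi 0, ψ y := by
  have h0 : ∫⁻ u : ℝ, ψ (|s - u| / κ) = ∫⁻ v : ℝ, ψ |κ⁻¹ * v| := by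
    rw [← lintegral_sub_left_eq_self (fun v : ℝ => ψ |κ⁻¹ * v|) s]
    refine lintegral_congr fun u => ?_
    rw [abs_mul, abs_of_pos (inv_pos.2 hκ), inv_mul_eq_div]
  have h1 := Real.smul_map_volume_mul_left (inv_pos.2 hκ).ne'
  have h2 : ∫⁻ v : ℝ, ψ |v| = ENNReal.ofReal κ⁻¹ * ∫⁻ v : ℝ, ψ |κ⁻¹ * v| := by
    conv_lhs => rw [← h1]
    rw [lintegral_smul_measure, lintegral_map (by fun_prop) (by fun_prop),
      abs_of_pos (inv_pos.2 hκ), smul_eq_mul]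
  rw [h0]
  rw [lint_abs] at h2
  rw [mul_comm (2 : ℝ), ENNReal.ofReal_mul hκ.le, mul_assoc,
    show ENNReal.ofReal 2 = 2 by norm_num, h2, ← mul_assoc, ← ENNReal.ofReal_mul hκ.le,
    mul_inv_cancel₀ hκ.ne']
  simp

/-- Truncated weight. -/
def WW (p M y : ℝ) : ℝ≥0∞ := (Ioo 0 M).indicator (fun y => ENNReal.ofReal (y ^ (p - 2))) y

lemma measurable_WW (p M : ℝ) : Measurable (WW p M) := by
  unfold WW
  exact Measurable.indicator (by fun_prop) measurableSet_Ioo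

lemma WW_of_mem {p M y : ℝ} (hy : y ∈ Ioo 0 M) : WW p M y = ENNReal.ofReal (y ^ (p - 2)) :=
  indicator_of_mem hy _

lemma WW_of_not_mem {p M y : ℝ} (hy : y ∉ Ioo 0 M) : WW p M y = 0 :=
  indicator_of_notMem hy _

lemma lint_WW (p M : ℝ) (k : ℝ → ℝ≥0∞) : ∫⁻ y in Ioi 0, WW p M y * k y =
    ∫⁻ y in Ioo 0 M, ENNReal.ofReal (y ^ (p - 2)) * k y := by
  have : ∀ y, WW p M y * k y = (Ioo 0 M).indicator
      (fun y => ENNReal.ofReal (y ^ (p - 2)) * k y) y := fun y => by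
    by_cases hy : y ∈ Ioo 0 M
    · rw [WW_of_mem hy, indicator_of_mem hy]
    · rw [WW_of_not_mem hy, indicator_of_notMem hy, zero_mul]
  simp only [this]
  rw [setLIntegral_indicator measurableSet_Ioo, inter_eq_left.2]
  exact fun x hx => hx.1

lemma hardy {p : ℝ} (hp0 : 0 < p) (hp1 : p < 1) (M : ℝ) {g : ℝ → ℝ≥0∞} (hg : Measurable g) :
    ∫⁻ y in Ioo 0 M, ENNReal.ofReal (y ^ (p - 2)) * (∫⁻ τ in Ioc 0 y, g τ) ^ 2 ≤
      ENNReal.ofReal (4 / (1 - p) ^ 2) * ∫⁻ τ in Ioo 0 M, g τ ^ 2 * ENNReal.ofReal (τ ^ p) := by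
  set a := (1 + p) / 2 with ha
  have ha1 : 0 < 1 - a := by rw [ha]; linarith
  have hap : 0 < a - p := by rw [ha]; linarith
  have h1p : 0 < 1 - p := by linarith
  have step1 : ∀ y ∈ Ioo 0 M, ENNReal.ofReal (y ^ (p - 2)) * (∫⁻ τ in Ioc 0 y, g τ) ^ 2 ≤
      ∫⁻ τ in Ioo 0 M, {w : ℝ × ℝ | w.2 ≤ w.1}.indicator (fun w => ENNReal.ofReal (w.1 ^ (p - 1 - a) / (1 - a)) *
        (g w.2 ^ 2 * ENNReal.ofReal (w.2 ^ a))) (y, τ) := by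
    intro y hy
    have hy0 : 0 < y := hy.1
    have hcs := cs_lintegral (μ := volume.restrict (Ioc 0 y))
      (a := fun τ => g τ * ENNReal.ofReal (τ ^ (a / 2))) (b := fun τ => ENNReal.ofReal (τ ^ (-a / 2)))
      (by fun_prop) (by fun_prop)
    have e1 : ∫⁻ τ in Ioc 0 y, g τ * ENNReal.ofReal (τ ^ (a / 2)) * ENNReal.ofReal (τ ^ (-a / 2)) =
        ∫⁻ τ in Ioc 0 y, g τ := by
      refine setLIntegral_congr_fun measurableSet_Ioc fun τ hτ => ?_
      have hτ0 : 0 < τ := hτ.1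
      rw [mul_assoc, ← ENNReal.ofReal_mul (by positivity), ← Real.rpow_add hτ0,
        show a / 2 + -a / 2 = 0 by ring, Real.rpow_zero]
      simp
    have e2 : ∫⁻ τ in Ioc 0 y, (ENNReal.ofReal (τ ^ (-a / 2))) ^ 2 =
        ENNReal.ofReal (y ^ (1 - a) / (1 - a)) := by
      have := lint_Ioc_rpow (q := -a) (a := y) (by linarith) hy0.le
      rw [show -a + 1 = 1 - a by ring] at this
      rw [← this]
      refine setLIntegral_congr_fun measurableSet_Ioc fun τ hτ => ?_
      have hτ0 : 0 < τ := hτ.1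
      rw [← ENNReal.ofReal_pow (by positivity), ← Real.rpow_natCast, ← Real.rpow_mul hτ0.le]
      congr 2; push_cast; ring
    have e3 : ∫⁻ τ in Ioc 0 y, (g τ * ENNReal.ofReal (τ ^ (a / 2))) ^ 2 =
        ∫⁻ τ in Ioc 0 y, g τ ^ 2 * ENNReal.ofReal (τ ^ a) := by
      refine setLIntegral_congr_fun measurableSet_Ioc fun τ hτ => ?_
      have hτ0 : 0 < τ := hτ.1
      rw [mul_pow, ← ENNReal.ofReal_pow (by positivity), ← Real.rpow_natCast, ← Real.rpow_mul hτ0.le]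
      congr 3; push_cast; ring
    rw [e1, e2, e3] at hcs
    calc _ ≤ ENNReal.ofReal (y ^ (p - 2)) * ((∫⁻ τ in Ioc 0 y, g τ ^ 2 * ENNReal.ofReal (τ ^ a)) *
          ENNReal.ofReal (y ^ (1 - a) / (1 - a))) := by gcongr
      _ = ENNReal.ofReal (y ^ (p - 1 - a) / (1 - a)) *
          ∫⁻ τ in Ioc 0 y, g τ ^ 2 * ENNReal.ofReal (τ ^ a) := by
          rw [mul_comm (∫⁻ τ in Ioc 0 y, _), ← mul_assoc, ← ENNReal.ofReal_mul (by positivity),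
            mul_div_assoc', ← Real.rpow_add hy0]
          congr 4; ring
      _ = ∫⁻ τ in Ioc 0 y, ENNReal.ofReal (y ^ (p - 1 - a) / (1 - a)) *
          (g τ ^ 2 * ENNReal.ofReal (τ ^ a)) := by
          rw [lintegral_const_mul' _ _ ENNReal.ofReal_ne_top]
      _ ≤ _ := by
          rw [← lintegral_indicator measurableSet_Ioc, ← lintegral_indicator measurableSet_Ioo]
          refine lintegral_mono fun τ => ?_
          by_cases hτ : τ ∈ Ioc 0 y
          · have h2 : τ ∈ Ioo 0 M := ⟨hτ.1, hτ.2.trans_lt hy.2⟩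
            have h3 : (y, τ) ∈ {w : ℝ × ℝ | w.2 ≤ w.1} := hτ.2
            rw [indicator_of_mem hτ, indicator_of_mem h2, indicator_of_mem h3]
          · rw [indicator_of_notMem hτ]; exact zero_le
  have hmeas : Measurable fun w : ℝ × ℝ => {w : ℝ × ℝ | w.2 ≤ w.1}.indicator
      (fun w => ENNReal.ofReal (w.1 ^ (p - 1 - a) / (1 - a)) *
        (g w.2 ^ 2 * ENNReal.ofReal (w.2 ^ a))) w := by
    refine Measurable.indicator ?_ (measurableSet_le measurable_snd measurable_fst)
    fun_prop
  refine (setLIntegral_mono' measurableSet_Ioo step1).trans ?_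
  rw [lintegral_lintegral_swap hmeas.aemeasurable, ← lintegral_const_mul' _ _ ENNReal.ofReal_ne_top]
  refine setLIntegral_mono' measurableSet_Ioo fun τ hτ => ?_
  have hτ0 : 0 < τ := hτ.1
  have hI := lint_Ioi_rpow (q := p - 1 - a) (a := τ) (by linarith) hτ0
  rw [show p - 1 - a + 1 = p - a by ring, neg_sub] at hI
  calc _ ≤ ∫⁻ y in Ici τ, ENNReal.ofReal (y ^ (p - 1 - a) / (1 - a)) *
        (g τ ^ 2 * ENNReal.ofReal (τ ^ a)) := by
        rw [← lintegral_indicator measurableSet_Ici]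
        refine (setLIntegral_le_lintegral _ _).trans (lintegral_mono fun y => ?_)
        exact le_rfl
    _ = ENNReal.ofReal (1 / (1 - a)) * ENNReal.ofReal (τ ^ (p - a) / (a - p)) *
        (g τ ^ 2 * ENNReal.ofReal (τ ^ a)) := by
        rw [setLIntegral_congr Ioi_ae_eq_Ici.symm, lintegral_mul_const _ (by fun_prop), ← hI,
          ← lintegral_const_mul' _ _ ENNReal.ofReal_ne_top]
        congr 1
        refine setLIntegral_congr_fun measurableSet_Ioi fun y hy => ?_
        have : 0 < y := hτ0.trans hy
        rw [← ENNReal.ofReal_mul (by positivity)]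
        congr 1; ring
    _ ≤ _ := by
        rw [mul_comm (g τ ^ 2), ← mul_assoc, ← ENNReal.ofReal_mul (by positivity),
          ← ENNReal.ofReal_mul (by positivity), mul_comm (g τ ^ 2), ← mul_assoc,
          ← ENNReal.ofReal_mul (by positivity)]
        apply le_of_eq
        congr 2
        have e : τ ^ (p - a) * τ ^ a = τ ^ p := by
          rw [← Real.rpow_add hτ0]; congr 1; ring
        have e2 : 1 - a = (1 - p) / 2 := by rw [ha]; ring
        have e3 : a - p = (1 - p) / 2 := by rw [ha]; ring
        calc _ = (1 / (1 - a)) * (1 / (a - p)) * (τ ^ (p - a) * τ ^ a) := by ring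
          _ = _ := by rw [e, e2, e3]; field_simp; norm_num


lemma three_sq (x y z : ℝ≥0∞) : (x + y + z) ^ 2 ≤ 3 * (x ^ 2 + y ^ 2 + z ^ 2) := by
  rcases eq_or_ne x ⊤ with rfl | hx
  · simp
  rcases eq_or_ne y ⊤ with rfl | hy
  · simp
  rcases eq_or_ne z ⊤ with rfl | hz
  · simp
  lift x to NNReal using hx
  lift y to NNReal using hy
  lift z to NNReal using hz
  norm_cast
  rw [← NNReal.coe_le_coe]
  push_cast
  nlinarith [sq_nonneg ((x : ℝ) - y), sq_nonneg ((y : ℝ) - z), sq_nonneg ((x : ℝ) - z)]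

/-- The area integral over a box. -/
def RR (p : ℝ) (f : ℝ → ℂ) (a b M : ℝ) : ℝ≥0∞ :=
  ∫⁻ φ in Ioo a b, ∫⁻ τ in Ioo 0 M, ENNReal.ofReal (GG f τ φ) * ENNReal.ofReal (τ ^ p)

/-- The kernel for the tangential part. -/
def hk (p : ℝ) (f : ℝ → ℂ) (κ M : ℝ) (s y φ : ℝ) : ℝ≥0∞ :=
  WW p M y * (ENNReal.ofReal (κ * y) * {w : ℝ × ℝ × ℝ | |w.1 - w.2.2| ≤ κ * w.2.1}.indicator
    (fun w => ENNReal.ofReal (GG f w.2.1 w.2.2)) (s, y, φ))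

lemma measurable_hk (p : ℝ) (f : ℝ → ℂ) (κ M : ℝ) :
    Measurable fun w : ℝ × ℝ × ℝ => hk p f κ M w.1 w.2.1 w.2.2 := by
  unfold hk
  have h1 : Measurable fun w : ℝ × ℝ × ℝ => WW p M w.2.1 :=
    (measurable_WW p M).comp (by fun_prop : Measurable fun w : ℝ × ℝ × ℝ => w.2.1)
  have h2 : Measurable fun w : ℝ × ℝ × ℝ => GG f w.2.1 w.2.2 :=
    (measurable_GG f).comp (measurable_snd : Measurable fun w : ℝ × ℝ × ℝ => w.2)
  have h3 : MeasurableSet {w : ℝ × ℝ × ℝ | |w.1 - w.2.2| ≤ κ * w.2.1} :=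
    measurableSet_le (by fun_prop) (by fun_prop)
  have h4 := h2.ennreal_ofReal.indicator h3
  refine h1.mul (Measurable.mul ?_ h4)
  fun_prop

lemma measurable_GG_left (f : ℝ → ℂ) (s : ℝ) : Measurable fun τ => GG f τ s := by
  have h : Measurable fun y : ℝ => (y, s) := by fun_prop
  have h2 := Measurable.comp (measurable_GG f) h
  simpa only [Function.comp_def] using h2

lemma measurable_GG_right (f : ℝ → ℂ) (s : ℝ) : Measurable fun φ => GG f s φ := by
  have h : Measurable fun y : ℝ => (s, y) := by fun_prop
  have h2 := Measurable.comp (measurable_GG f) h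
  simpa only [Function.comp_def] using h2

lemma A_part {p : ℝ} (hp0 : 0 < p) (hp1 : p < 1) (f : ℝ → ℂ) {κ : ℝ} (hκ : 0 < κ) (M a b s : ℝ) :
    ∫⁻ u in Ioo a b, WW p M (|s - u| / κ) * Aint f s (|s - u| / κ) ^ 2 ≤
      ENNReal.ofReal (2 * κ * (4 / (1 - p) ^ 2)) *
        ∫⁻ τ in Ioo 0 M, ENNReal.ofReal (GG f τ s) * ENNReal.ofReal (τ ^ p) := by
  refine (setLIntegral_le_lintegral _ _).trans ?_
  have hA : Measurable fun y => Aint f s y :=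
    (measurable_Aint f).comp (by fun_prop : Measurable fun y : ℝ => (s, y))
  have hG := measurable_GG_left f s
  have e1 := polar1 hκ (ψ := fun y => WW p M y * Aint f s y ^ 2)
    ((measurable_WW p M).mul (hA.pow_const 2)) s
  have e2 := lint_WW p M (fun y => Aint f s y ^ 2)
  have e3 := hardy hp0 hp1 M hG.sqrt.ennreal_ofReal
  have e4 : ∫⁻ τ in Ioo 0 M, ENNReal.ofReal √(GG f τ s) ^ 2 * ENNReal.ofReal (τ ^ p) =
      ∫⁻ τ in Ioo 0 M, ENNReal.ofReal (GG f τ s) * ENNReal.ofReal (τ ^ p) :=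
    lintegral_congr fun τ => by rw [sq_ofReal_sqrt (GG_nonneg f τ s)]
  have e5 : ENNReal.ofReal (2 * κ * (4 / (1 - p) ^ 2)) =
      ENNReal.ofReal (2 * κ) * ENNReal.ofReal (4 / (1 - p) ^ 2) :=
    ENNReal.ofReal_mul (by positivity)
  rw [e4] at e3
  rw [e5, mul_assoc, e1, e2]
  exact mul_le_mul_right e3 _

lemma B_part (p : ℝ) (f : ℝ → ℂ) {κ : ℝ} (hκ : 0 < κ) (M a b : ℝ) :
    ∫⁻ s in Ioo a b, ∫⁻ u in Ioo a b, ∫⁻ φ in Ioo a b, hk p f κ M s (|s - u| / κ) φ ≤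
      ENNReal.ofReal (2 * κ * (2 * κ ^ 2)) * RR p f a b M := by
  have hm := measurable_hk p f κ M
  have h1 : ∀ s, ∫⁻ u in Ioo a b, ∫⁻ φ in Ioo a b, hk p f κ M s (|s - u| / κ) φ ≤
      ENNReal.ofReal (2 * κ) * ∫⁻ y in Ioi 0, ∫⁻ φ in Ioo a b, hk p f κ M s y φ := by
    intro s
    refine (setLIntegral_le_lintegral _ _).trans ?_
    rw [polar1 hκ (ψ := fun y => ∫⁻ φ in Ioo a b, hk p f κ M s y φ)]
    exact Measurable.lintegral_prod_right' (f := fun w : ℝ × ℝ => hk p f κ M s w.1 w.2)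
      (hm.comp (measurable_const.prodMk measurable_id))
  have h2 : ∀ y ∈ Ioi (0 : ℝ), ∀ φ, ∫⁻ s, hk p f κ M s y φ ≤
      WW p M y * (ENNReal.ofReal (2 * κ ^ 2 * y ^ 2) * ENNReal.ofReal (GG f y φ)) := by
    intro y hy φ
    have hy0 : 0 < y := hy
    have hW : WW p M y ≠ ⊤ := by
      by_cases h : y ∈ Ioo 0 M
      · rw [WW_of_mem h]; exact ENNReal.ofReal_ne_top
      · rw [WW_of_not_mem h]; exact ENNReal.zero_ne_top
    have e : ∀ s, hk p f κ M s y φ = WW p M y * (ENNReal.ofReal (κ * y) *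
        (Icc (φ - κ * y) (φ + κ * y)).indicator (fun _ => ENNReal.ofReal (GG f y φ)) s) := by
      intro s
      unfold hk
      congr 2
      by_cases hs : |s - φ| ≤ κ * y
      · rw [indicator_of_mem (show (s, y, φ) ∈ _ from hs), indicator_of_mem]
        rw [abs_le] at hs
        constructor <;> linarith [hs.1, hs.2]
      · rw [indicator_of_notMem (show (s, y, φ) ∉ _ from hs), indicator_of_notMem]
        intro h
        apply hs
        rw [abs_le]
        constructor <;> linarith [h.1, h.2]
    simp only [e]
    rw [lintegral_const_mul' _ _ hW, lintegral_const_mul' _ _ ENNReal.ofReal_ne_top,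
      lintegral_indicator measurableSet_Icc, setLIntegral_const, Real.volume_Icc]
    apply le_of_eq
    congr 1
    rw [mul_comm (ENNReal.ofReal (GG f y φ)), ← mul_assoc, ← ENNReal.ofReal_mul (by positivity)]
    congr 2; ring
  calc _ ≤ ∫⁻ s in Ioo a b, ENNReal.ofReal (2 * κ) * ∫⁻ y in Ioi 0, ∫⁻ φ in Ioo a b,
        hk p f κ M s y φ := lintegral_mono h1
    _ ≤ ENNReal.ofReal (2 * κ) * ∫⁻ s, ∫⁻ y in Ioi 0, ∫⁻ φ in Ioo a b, hk p f κ M s y φ := by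
        rw [lintegral_const_mul' _ _ ENNReal.ofReal_ne_top]
        gcongr
        exact Measure.restrict_le_self
    _ = ENNReal.ofReal (2 * κ) * ∫⁻ y in Ioi 0, ∫⁻ φ in Ioo a b, ∫⁻ s, hk p f κ M s y φ := by
        rw [lintegral_lintegral_swap]
        · congr 1
          refine lintegral_congr fun y => ?_
          rw [lintegral_lintegral_swap]
          apply Measurable.aemeasurable
          exact hm.comp (by fun_prop : Measurable fun w : ℝ × ℝ => (w.1, y, w.2))
        · apply Measurable.aemeasurable
          apply Measurable.lintegral_prod_right' (f := fun w : (ℝ × ℝ) × ℝ =>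
            hk p f κ M w.1.1 w.1.2 w.2)
          exact hm.comp (by fun_prop : Measurable fun w : (ℝ × ℝ) × ℝ => (w.1.1, w.1.2, w.2))
    _ ≤ ENNReal.ofReal (2 * κ) * ∫⁻ y in Ioi 0, ∫⁻ φ in Ioo a b,
          WW p M y * (ENNReal.ofReal (2 * κ ^ 2 * y ^ 2) * ENNReal.ofReal (GG f y φ)) := by
        refine mul_le_mul_right ?_ _
        exact setLIntegral_mono' measurableSet_Ioi fun y hy => lintegral_mono fun φ => h2 y hy φ
    _ = ENNReal.ofReal (2 * κ) * ∫⁻ φ in Ioo a b, ∫⁻ y in Ioi 0,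
          WW p M y * (ENNReal.ofReal (2 * κ ^ 2 * y ^ 2) * ENNReal.ofReal (GG f y φ)) := by
        rw [lintegral_lintegral_swap]
        apply Measurable.aemeasurable
        have h1 : Measurable fun w : ℝ × ℝ => WW p M w.1 := (measurable_WW p M).comp measurable_fst
        refine h1.mul (Measurable.mul ?_ (measurable_GG f).ennreal_ofReal)
        fun_prop
    _ = _ := by
        rw [ENNReal.ofReal_mul (p := 2 * κ) (by positivity), mul_assoc]
        congr 1
        unfold RR
        rw [← lintegral_const_mul' _ _ ENNReal.ofReal_ne_top]
        refine lintegral_congr fun φ => ?_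
        rw [lint_WW, ← lintegral_const_mul' _ _ ENNReal.ofReal_ne_top]
        refine setLIntegral_congr_fun measurableSet_Ioo fun y hy => ?_
        have hy0 : 0 < y := hy.1
        change ENNReal.ofReal (y ^ (p - 2)) * (ENNReal.ofReal (2 * κ ^ 2 * y ^ 2) *
          ENNReal.ofReal (GG f y φ)) = ENNReal.ofReal (2 * κ ^ 2) * (ENNReal.ofReal (GG f y φ) *
          ENNReal.ofReal (y ^ p))
        have e : y ^ p = y ^ (p - 2) * y ^ 2 := by
          rw [← Real.rpow_two, ← Real.rpow_add hy0]; congr 1; ring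
        rw [e, ENNReal.ofReal_mul (p := 2 * κ ^ 2) (by positivity),
          ENNReal.ofReal_mul (p := y ^ (p - 2)) (by positivity)]
        ring


lemma lint_add3 {α : Type*} [MeasurableSpace α] {μ : Measure α} (F G H : α → ℝ≥0∞)
    (hF : Measurable F) (hG : Measurable G) :
    ∫⁻ x, 3 * (F x + G x + H x) ∂μ = 3 * (∫⁻ x, F x ∂μ + ∫⁻ x, G x ∂μ + ∫⁻ x, H x ∂μ) := by
  have hFG : Measurable fun x => F x + G x := hF.add hG
  rw [lintegral_const_mul' _ _ (by norm_num), lintegral_add_left hFG, lintegral_add_left hF]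

lemma B_sq (p : ℝ) (f : ℝ → ℂ) {κ : ℝ} (hκ : 0 < κ) (M : ℝ) {a b s u : ℝ}
    (hs : s ∈ Ioo a b) (hu : u ∈ Ioo a b) :
    WW p M (|s - u| / κ) * (∫⁻ φ in uIcc s u, ENNReal.ofReal √(GG f (|s - u| / κ) φ)) ^ 2 ≤
      ∫⁻ φ in Ioo a b, hk p f κ M s (|s - u| / κ) φ := by
  set y := |s - u| / κ with hy
  have hG := measurable_GG_right f y
  have hκy : κ * y = |s - u| := by rw [hy]; field_simp
  have hcs := cs_lintegral (μ := volume.restrict (uIcc s u)) (a := fun _ => 1)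
    (b := fun φ => ENNReal.ofReal √(GG f y φ)) aemeasurable_const hG.sqrt.ennreal_ofReal.aemeasurable
  simp only [one_mul, one_pow, lintegral_const, Measure.restrict_apply_univ] at hcs
  have hvol : volume (uIcc s u) = ENNReal.ofReal (κ * y) := by
    rw [uIcc, Real.volume_Icc, max_sub_min_eq_abs', hκy]
  rw [hvol] at hcs
  have hW : WW p M y ≠ ⊤ := by
    by_cases h : y ∈ Ioo 0 M
    · rw [WW_of_mem h]; exact ENNReal.ofReal_ne_top
    · rw [WW_of_not_mem h]; exact ENNReal.zero_ne_top
  unfold hk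
  rw [lintegral_const_mul' _ _ hW, lintegral_const_mul' _ _ ENNReal.ofReal_ne_top]
  gcongr
  refine hcs.trans ?_
  refine mul_le_mul_right ?_ _
  have hsub : uIcc s u ⊆ Ioo a b := by
    intro x hx
    rw [uIcc, mem_Icc] at hx
    exact ⟨(lt_min hs.1 hu.1).trans_le hx.1, hx.2.trans_lt (max_lt hs.2 hu.2)⟩
  calc _ ≤ ∫⁻ φ in uIcc s u, {w : ℝ × ℝ × ℝ | |w.1 - w.2.2| ≤ κ * w.2.1}.indicator
        (fun w => ENNReal.ofReal (GG f w.2.1 w.2.2)) (s, y, φ) := by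
        refine setLIntegral_mono' measurableSet_uIcc fun φ hφ => ?_
        rw [indicator_of_mem, sq_ofReal_sqrt (GG_nonneg f y φ)]
        change |s - φ| ≤ κ * y
        rw [hκy]
        rw [abs_sub_comm s φ, abs_sub_comm s u]
        exact abs_sub_left_of_mem_uIcc hφ
    _ ≤ _ := lintegral_mono_set hsub

lemma main_double {p : ℝ} (hp0 : 0 < p) (hp1 : p < 1) {f : ℝ → ℂ} (hfm : Measurable f)
    (hfper : Function.Periodic f (2 * π)) (hf : IntervalIntegrable f volume 0 (2 * π))
    {κ : ℝ} (hκ : 0 < κ) {M : ℝ} (hM : M ≤ 1) (a b : ℝ) :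
    ∃ D : ℝ, D = 3 * (2 * κ * (4 / (1 - p) ^ 2) + 2 * κ * (4 / (1 - p) ^ 2) + 2 * κ * (2 * κ ^ 2)) ∧
    ∫⁻ s in Ioo a b, ∫⁻ u in Ioo a b, ENNReal.ofReal (‖f s - f u‖ ^ 2) * WW p M (|s - u| / κ) ≤
      ENNReal.ofReal D * RR p f a b M := by
  refine ⟨_, rfl, ?_⟩
  have h1p : 0 < 1 - p := by linarith
  have hWm : Measurable fun w : ℝ × ℝ => WW p M (|w.1 - w.2| / κ) :=
    (measurable_WW p M).comp (by fun_prop : Measurable fun w : ℝ × ℝ => |w.1 - w.2| / κ)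
  have hA1 : Measurable fun w : ℝ × ℝ => WW p M (|w.1 - w.2| / κ) *
      Aint f w.1 (|w.1 - w.2| / κ) ^ 2 :=
    hWm.mul (((measurable_Aint f).comp
      (by fun_prop : Measurable fun w : ℝ × ℝ => (w.1, |w.1 - w.2| / κ))).pow_const 2)
  have hA2 : Measurable fun w : ℝ × ℝ => WW p M (|w.1 - w.2| / κ) *
      Aint f w.2 (|w.1 - w.2| / κ) ^ 2 :=
    hWm.mul (((measurable_Aint f).comp
      (by fun_prop : Measurable fun w : ℝ × ℝ => (w.2, |w.1 - w.2| / κ))).pow_const 2)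
  have hB : Measurable fun w : ℝ × ℝ => ∫⁻ φ in Ioo a b, hk p f κ M w.1 (|w.1 - w.2| / κ) φ := by
    apply Measurable.lintegral_prod_right' (f := fun w : (ℝ × ℝ) × ℝ =>
      hk p f κ M w.1.1 (|w.1.1 - w.1.2| / κ) w.2)
    exact (measurable_hk p f κ M).comp
      (by fun_prop : Measurable fun w : (ℝ × ℝ) × ℝ => (w.1.1, |w.1.1 - w.1.2| / κ, w.2))
  have I1 : ∫⁻ s in Ioo a b, ∫⁻ u in Ioo a b, WW p M (|s - u| / κ) * Aint f s (|s - u| / κ) ^ 2 ≤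
      ENNReal.ofReal (2 * κ * (4 / (1 - p) ^ 2)) * RR p f a b M := by
    unfold RR
    rw [← lintegral_const_mul' _ _ ENNReal.ofReal_ne_top]
    exact lintegral_mono fun s => A_part hp0 hp1 f hκ M a b s
  have I2 : ∫⁻ s in Ioo a b, ∫⁻ u in Ioo a b, WW p M (|s - u| / κ) * Aint f u (|s - u| / κ) ^ 2 ≤
      ENNReal.ofReal (2 * κ * (4 / (1 - p) ^ 2)) * RR p f a b M := by
    rw [lintegral_lintegral_swap hA2.aemeasurable]
    simp only [fun x y : ℝ => abs_sub_comm y x] at I1 ⊢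
    exact I1
  have I3 := B_part p f hκ M a b
  have key : ∀ᵐ s ∂volume.restrict (Ioo a b), ∀ᵐ u ∂volume.restrict (Ioo a b),
      ENNReal.ofReal (‖f s - f u‖ ^ 2) * WW p M (|s - u| / κ) ≤
      3 * (WW p M (|s - u| / κ) * Aint f s (|s - u| / κ) ^ 2 +
        WW p M (|s - u| / κ) * Aint f u (|s - u| / κ) ^ 2 +
        ∫⁻ φ in Ioo a b, hk p f κ M s (|s - u| / κ) φ) := by
    filter_upwards [ae_restrict_of_ae (path_ineq hfm hfper hf), ae_restrict_mem measurableSet_Ioo]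
      with s hs hsm
    filter_upwards [ae_restrict_of_ae hs, ae_restrict_mem measurableSet_Ioo] with u hu hum
    by_cases hy : |s - u| / κ ∈ Ioo 0 M
    · have h := hu _ ⟨hy.1, hy.2.trans_le hM⟩
      have hb := B_sq p f hκ M hsm hum
      have e : ENNReal.ofReal (‖f s - f u‖ ^ 2) = ‖f s - f u‖ₑ ^ 2 := by
        rw [ENNReal.ofReal_pow (norm_nonneg _), ofReal_norm_eq_enorm]
      rw [e]
      calc _ ≤ (3 * (Aint f s (|s - u| / κ) ^ 2 + Aint f u (|s - u| / κ) ^ 2 +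
            (∫⁻ φ in uIcc s u, ENNReal.ofReal √(GG f (|s - u| / κ) φ)) ^ 2)) *
            WW p M (|s - u| / κ) := by
            gcongr
            exact (pow_le_pow_left' h 2).trans (three_sq _ _ _)
        _ = 3 * (WW p M (|s - u| / κ) * Aint f s (|s - u| / κ) ^ 2 +
              WW p M (|s - u| / κ) * Aint f u (|s - u| / κ) ^ 2 +
              WW p M (|s - u| / κ) *
                (∫⁻ φ in uIcc s u, ENNReal.ofReal √(GG f (|s - u| / κ) φ)) ^ 2) := by ring
        _ ≤ _ := by gcongr
    · rw [WW_of_not_mem hy]; simp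
  calc _ ≤ ∫⁻ s in Ioo a b, ∫⁻ u in Ioo a b,
      3 * (WW p M (|s - u| / κ) * Aint f s (|s - u| / κ) ^ 2 +
        WW p M (|s - u| / κ) * Aint f u (|s - u| / κ) ^ 2 +
        ∫⁻ φ in Ioo a b, hk p f κ M s (|s - u| / κ) φ) :=
        lintegral_mono_ae (key.mono fun s hs => lintegral_mono_ae hs)
    _ = 3 * ((∫⁻ s in Ioo a b, ∫⁻ u in Ioo a b, WW p M (|s - u| / κ) * Aint f s (|s - u| / κ) ^ 2) +
        (∫⁻ s in Ioo a b, ∫⁻ u in Ioo a b, WW p M (|s - u| / κ) * Aint f u (|s - u| / κ) ^ 2) +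
        ∫⁻ s in Ioo a b, ∫⁻ u in Ioo a b, ∫⁻ φ in Ioo a b, hk p f κ M s (|s - u| / κ) φ) := by
        have e : ∀ s, ∫⁻ u in Ioo a b,
            3 * (WW p M (|s - u| / κ) * Aint f s (|s - u| / κ) ^ 2 +
            WW p M (|s - u| / κ) * Aint f u (|s - u| / κ) ^ 2 +
            ∫⁻ φ in Ioo a b, hk p f κ M s (|s - u| / κ) φ) =
            3 * ((∫⁻ u in Ioo a b, WW p M (|s - u| / κ) * Aint f s (|s - u| / κ) ^ 2) +
            (∫⁻ u in Ioo a b, WW p M (|s - u| / κ) * Aint f u (|s - u| / κ) ^ 2) +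
            ∫⁻ u in Ioo a b, ∫⁻ φ in Ioo a b, hk p f κ M s (|s - u| / κ) φ) := by
          intro s
          have m1 := hA1.comp (measurable_prodMk_left (x := s))
          have m2 := hA2.comp (measurable_prodMk_left (x := s))
          exact lint_add3 _ _ _ m1 m2
        simp only [e]
        have M1 := hA1.lintegral_prod_right' (ν := volume.restrict (Ioo a b))
        have M2 := hA2.lintegral_prod_right' (ν := volume.restrict (Ioo a b))
        exact lint_add3 _ _ _ M1 M2
    _ ≤ 3 * (ENNReal.ofReal (2 * κ * (4 / (1 - p) ^ 2)) * RR p f a b M +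
          ENNReal.ofReal (2 * κ * (4 / (1 - p) ^ 2)) * RR p f a b M +
          ENNReal.ofReal (2 * κ * (2 * κ ^ 2)) * RR p f a b M) := by gcongr
    _ = _ := by
        rw [ENNReal.ofReal_mul (p := 3) (by norm_num), ENNReal.ofReal_add (by positivity) (by positivity),
          ENNReal.ofReal_add (by positivity) (by positivity), ENNReal.ofReal_ofNat]
        ring


lemma kern_le {p : ℝ} (hp0 : 0 < p) (hp1 : p < 1) (f : ℝ → ℂ) {κ M s u : ℝ} (hκ : 1 ≤ κ)
    (h1 : |s - u| ≤ π) (h2 : |s - u| < κ * M) :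
    ENNReal.ofReal (‖f s - f u‖ ^ 2 / ‖ee s - ee u‖ ^ (2 - p)) ≤
      25 * (ENNReal.ofReal (‖f s - f u‖ ^ 2) * WW p M (|s - u| / κ)) := by
  have hκ0 : 0 < κ := by linarith
  rcases eq_or_ne s u with rfl | hne
  · simp
  have hd : 0 < |s - u| := abs_pos.2 (sub_ne_zero.2 hne)
  have hmem : |s - u| / κ ∈ Ioo 0 M := ⟨by positivity, by rw [div_lt_iff₀ hκ0]; linarith⟩
  have hc := chord_ge' h1
  set d := |s - u| with hdd
  have hp2 : 0 < 2 - p := by linarith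
  rw [WW_of_mem hmem, ← ENNReal.ofReal_mul (by positivity),
    show (25 : ℝ≥0∞) = ENNReal.ofReal 25 by simp, ← ENNReal.ofReal_mul (by positivity)]
  apply ENNReal.ofReal_le_ofReal
  have a1 : (d / 5) ^ (2 - p) ≤ ‖ee s - ee u‖ ^ (2 - p) :=
    Real.rpow_le_rpow (by positivity) hc hp2.le
  have a2 : ‖f s - f u‖ ^ 2 / ‖ee s - ee u‖ ^ (2 - p) ≤ ‖f s - f u‖ ^ 2 / (d / 5) ^ (2 - p) := by
    gcongr
  refine a2.trans ?_
  have a3 : (d / κ) ^ (p - 2) = κ ^ (2 - p) / d ^ (2 - p) := by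
    rw [show p - 2 = -(2 - p) by ring, Real.rpow_neg (by positivity),
      Real.div_rpow (by positivity) (by positivity), inv_div]
  have a4 : (d / 5) ^ (2 - p) = d ^ (2 - p) / 5 ^ (2 - p) :=
    Real.div_rpow (by positivity) (by positivity) _
  have a5 : (5 : ℝ) ^ (2 - p) ≤ 25 := by
    calc (5 : ℝ) ^ (2 - p) ≤ 5 ^ (2 : ℝ) :=
          Real.rpow_le_rpow_of_exponent_le (by norm_num) (by linarith)
      _ = 25 := by norm_num
  have a6 : 1 ≤ κ ^ (2 - p) := Real.one_le_rpow hκ hp2.le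
  have a7 : 0 < d ^ (2 - p) := by positivity
  rw [a3, a4, div_div_eq_mul_div]
  rw [show 25 * (‖f s - f u‖ ^ 2 * (κ ^ (2 - p) / d ^ (2 - p))) =
    (‖f s - f u‖ ^ 2 * (25 * κ ^ (2 - p))) / d ^ (2 - p) by ring]
  gcongr
  nlinarith

lemma RR_le {p : ℝ} (hp0 : 0 < p) (f : ℝ → ℂ) (θ : ℝ) {h : ℝ} (hh : h ∈ Ioc (0 : ℝ) 1) :
    RR p f (θ - π * h) (θ + π * h) (h / 2) ≤ 2 * diskMeasure (dens p f) (carlesonBox θ h) :=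
  box_lower hp0 f θ hh

lemma RR_big {p : ℝ} (hp0 : 0 < p) (f : ℝ → ℂ) (θ : ℝ) :
    RR p f (θ - 2 * π) (θ + 2 * π) (1 / 4) ≤
      2 * diskMeasure (dens p f) (carlesonBox (θ - π) 1) +
      2 * diskMeasure (dens p f) (carlesonBox (θ + π) 1) := by
  have hπ := Real.pi_pos
  have h1 := RR_le hp0 f (θ - π) (h := 1) ⟨by norm_num, le_rfl⟩
  have h2 := RR_le hp0 f (θ + π) (h := 1) ⟨by norm_num, le_rfl⟩
  refine le_trans ?_ (add_le_add h1 h2)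
  unfold RR
  rw [show θ - π - π * 1 = θ - 2 * π by ring, show θ - π + π * 1 = θ by ring,
    show θ + π - π * 1 = θ by ring, show θ + π + π * 1 = θ + 2 * π by ring]
  set F : ℝ → ℝ≥0∞ := fun φ => ∫⁻ τ in Ioo 0 (1 / 2), ENNReal.ofReal (GG f τ φ) *
    ENNReal.ofReal (τ ^ p) with hF
  calc _ ≤ ∫⁻ φ in Ioo (θ - 2 * π) (θ + 2 * π), F φ :=
        lintegral_mono fun φ => lintegral_mono_set (Ioo_subset_Ioo_right (by norm_num))
    _ ≤ ∫⁻ φ in Ioc (θ - 2 * π) θ ∪ Ioc θ (θ + 2 * π), F φ := by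
        apply lintegral_mono_set
        intro x hx
        rcases le_or_gt x θ with h | h
        · exact Or.inl ⟨hx.1, h⟩
        · exact Or.inr ⟨h, hx.2.le⟩
    _ ≤ (∫⁻ φ in Ioc (θ - 2 * π) θ, F φ) + ∫⁻ φ in Ioc θ (θ + 2 * π), F φ :=
        lintegral_union_le _ _ _
    _ = _ := by
        rw [setLIntegral_congr (Ioo_ae_eq_Ioc (a := θ - 2 * π) (b := θ)).symm,
          setLIntegral_congr (Ioo_ae_eq_Ioc (a := θ) (b := θ + 2 * π)).symm]

lemma backward {p : ℝ} (hp0 : 0 < p) (hp1 : p < 1) {f : ℝ → ℂ} (hfm : Measurable f)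
    (hfper : Function.Periodic f (2 * π)) (hfL2 : l2Circle f < ⊤) {C : ℝ} (hC : 0 ≤ C)
    (hμ : ∀ θ : ℝ, ∀ h ∈ Ioc (0 : ℝ) 1,
      diskMeasure (dens p f) (carlesonBox θ h) ≤ ENNReal.ofReal (C * h ^ p)) :
    ∃ C' : ℝ, ∀ θ : ℝ, ∀ h ∈ Ioc (0 : ℝ) 1, qpTDouble p f θ h ≤ ENNReal.ofReal (C' * h ^ p) := by
  have hπ := Real.pi_pos
  have hπ3 := Real.pi_gt_three
  have hf := intervalIntegrable_of_l2 hfm hfL2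
  have hκ0 : (0 : ℝ) < 4 * π := by positivity
  have hκ1 : (1 : ℝ) ≤ 4 * π := by linarith
  have h1p : 0 < 1 - p := by linarith
  obtain ⟨D, hD⟩ : ∃ D : ℝ, D = 3 * (2 * (4 * π) * (4 / (1 - p) ^ 2) +
    2 * (4 * π) * (4 / (1 - p) ^ 2) + 2 * (4 * π) * (2 * (4 * π) ^ 2)) := ⟨_, rfl⟩
  have hD0 : 0 ≤ D := by rw [hD]; positivity
  have main : ∀ M ≤ (1 : ℝ), ∀ a b, ∫⁻ s in Ioo a b, ∫⁻ u in Ioo a b,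
      ENNReal.ofReal (‖f s - f u‖ ^ 2) * WW p M (|s - u| / (4 * π)) ≤
      ENNReal.ofReal D * RR p f a b M := by
    intro M hM a b
    obtain ⟨D', e, h⟩ := main_double hp0 hp1 hfm hfper hf hκ0 hM a b
    rw [← hD] at e
    rwa [e] at h
  refine ⟨25 * (D * (8 * C)), fun θ h hh => ?_⟩
  have hhp : 0 ≤ h ^ p := Real.rpow_nonneg hh.1.le p
  have h25 : (25 : ℝ≥0∞) = ENNReal.ofReal 25 := by simp
  rcases le_or_gt h (1 / 2) with hs | hl
  · have s1 : qpTDouble p f θ h ≤ ∫⁻ s in arcInterval θ h, ∫⁻ u in arcInterval θ h,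
        25 * (ENNReal.ofReal (‖f s - f u‖ ^ 2) * WW p (h / 2) (|s - u| / (4 * π))) := by
      refine setLIntegral_mono' (measurableSet_arc θ h) fun s hs' =>
        setLIntegral_mono' (measurableSet_arc θ h) fun u hu => ?_
      have hd : |s - u| < 2 * π * h := by
        rw [mem_arc] at hs' hu
        calc |s - u| = |(s - θ) - (u - θ)| := by ring_nf
          _ ≤ |s - θ| + |u - θ| := abs_sub _ _
          _ < _ := by linarith
      exact kern_le hp0 hp1 f hκ1 (by nlinarith) (by linarith)
    simp only [lintegral_const_mul' _ _ (by norm_num : (25 : ℝ≥0∞) ≠ ⊤)] at s1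
    have s2 := main (h / 2) (by linarith) (θ - π * h) (θ + π * h)
    have s3 := (RR_le hp0 f θ hh).trans (mul_le_mul_right (hμ θ h hh) 2)
    calc _ ≤ 25 * (ENNReal.ofReal D * (2 * ENNReal.ofReal (C * h ^ p))) :=
          s1.trans (mul_le_mul_right (s2.trans (mul_le_mul_right s3 _)) _)
      _ = ENNReal.ofReal (25 * (D * (2 * (C * h ^ p)))) := by
          rw [ENNReal.ofReal_mul (p := 25) (by norm_num), ENNReal.ofReal_mul hD0,
            ENNReal.ofReal_mul (p := 2) (by norm_num), h25]
          simp
      _ ≤ _ := by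
          apply ENNReal.ofReal_le_ofReal
          have : 0 ≤ D * (C * h ^ p) := by positivity
          nlinarith
  · set K : ℝ → ℝ → ℝ≥0∞ := fun s u =>
      ENNReal.ofReal (‖f s - f u‖ ^ 2 / ‖ee s - ee u‖ ^ (2 - p)) with hK
    have hKper : ∀ s, Function.Periodic (K s) (2 * π) := by
      intro s u
      simp only [hK]
      rw [hfper u, ee_periodic u]
    have s0 : qpTDouble p f θ h ≤ ∫⁻ s in arcInterval θ 1, ∫⁻ u in arcInterval s 1, K s u := by
      calc qpTDouble p f θ h ≤ ∫⁻ s in arcInterval θ 1, ∫⁻ u in arcInterval θ 1, K s u :=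
            (lintegral_mono_set (arc_mono θ hh.2)).trans
              (lintegral_mono fun s => lintegral_mono_set (arc_mono θ hh.2))
        _ = _ := lintegral_congr fun s => by
            rw [lint_arc_one (hKper s) θ 0, lint_arc_one (hKper s) s 0]
    have s1 : qpTDouble p f θ h ≤ ∫⁻ s in Ioo (θ - 2 * π) (θ + 2 * π),
        ∫⁻ u in Ioo (θ - 2 * π) (θ + 2 * π),
        25 * (ENNReal.ofReal (‖f s - f u‖ ^ 2) * WW p (1 / 4) (|s - u| / (4 * π))) := by
      refine s0.trans ?_
      refine le_trans ?_ (lintegral_mono_set (s := arcInterval θ 1) ?_)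
      · refine setLIntegral_mono' (measurableSet_arc θ 1) fun s hs' => ?_
        rw [mem_arc, mul_one, abs_lt] at hs'
        refine le_trans ?_ (lintegral_mono_set (s := arcInterval s 1) ?_)
        · refine setLIntegral_mono' (measurableSet_arc s 1) fun u hu => ?_
          rw [mem_arc, mul_one, abs_sub_comm] at hu
          exact kern_le hp0 hp1 f hκ1 hu.le (by linarith)
        · intro u hu
          rw [mem_arc, mul_one, abs_lt] at hu
          constructor <;> linarith [hu.1, hu.2, hs'.1, hs'.2]
      · intro u hu
        rw [mem_arc, mul_one, abs_lt] at hu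
        constructor <;> linarith [hu.1, hu.2]
    simp only [lintegral_const_mul' _ _ (by norm_num : (25 : ℝ≥0∞) ≠ ⊤)] at s1
    have s2 := main (1 / 4) (by norm_num) (θ - 2 * π) (θ + 2 * π)
    have o1 : (1 : ℝ) ∈ Ioc (0 : ℝ) 1 := ⟨by norm_num, le_rfl⟩
    have s3 := (RR_big hp0 f θ).trans (add_le_add (mul_le_mul_right (hμ (θ - π) 1 o1) 2)
      (mul_le_mul_right (hμ (θ + π) 1 o1) 2))
    rw [Real.one_rpow, mul_one] at s3
    calc _ ≤ 25 * (ENNReal.ofReal D * (2 * ENNReal.ofReal C + 2 * ENNReal.ofReal C)) :=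
          s1.trans (mul_le_mul_right (s2.trans (mul_le_mul_right s3 _)) _)
      _ = ENNReal.ofReal (25 * (D * (2 * C + 2 * C))) := by
          rw [ENNReal.ofReal_mul (p := 25) (by norm_num), ENNReal.ofReal_mul hD0,
            ENNReal.ofReal_add (by positivity) (by positivity),
            ENNReal.ofReal_mul (p := 2) (by norm_num), h25]
          simp
      _ ≤ _ := by
          apply ENNReal.ofReal_le_ofReal
          have hhalf : 1 / 2 ≤ h ^ p := by
            have := Real.rpow_le_rpow_of_exponent_ge hh.1 hh.2 hp1.le
            rw [Real.rpow_one] at this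
            linarith
          have : 0 ≤ D * C := by positivity
          nlinarith

/-- For `0 < p < 1`: `f ∈ L²(𝕋)` belongs to `Q_p(𝕋)` if and only if
`|∇f̃(z)|² (1-|z|²)^p dA(z)` is a `p`-Carleson measure, where `f̃` is the Poisson
integral of `f`. -/
theorem memQpT_iff_poisson_pCarleson (p : ℝ) (hp0 : 0 < p) (hp1 : p < 1)
    (f : ℝ → ℂ) (hfm : Measurable f) (hfper : Function.Periodic f (2 * Real.pi))
    (hfL2 : l2Circle f < ⊤) :
    MemQpT p f ↔
      IsPCarleson p
        (diskMeasure fun z => gradSq (poissonExt f) z * (1 - ‖z‖ ^ 2) ^ p) := by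
  constructor
  · rintro ⟨-, -, -, C, hC⟩
    refine forward hp0 hp1 hfm hfper hfL2 (le_max_right C 0) fun θ h hh => (hC θ h hh).trans ?_
    apply ENNReal.ofReal_le_ofReal
    have hhp : 0 ≤ h ^ p := Real.rpow_nonneg hh.1.le p
    gcongr
    exact le_max_left _ _
  · rintro ⟨C, hC⟩
    refine ⟨hfper, hfm, hfL2, backward hp0 hp1 hfm hfper hfL2 (le_max_right C 0)
      fun θ h hh => (hC θ h hh).trans ?_⟩
    apply ENNReal.ofReal_le_ofReal
    have hhp : 0 ≤ h ^ p := Real.rpow_nonneg hh.1.le p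
    gcongr
    exact le_max_left _ _

end
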